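/- arXiv:1807.08557 — 2 statements merged into one kernel-verified Lean document; each statement's English description precedes it below -/
import Mathlib

section
/- Let P ∈ ℂ[X_1,…,X_d] be a nonzero polynomial and X ⊆ ℝ^d open. For n ∈ ℕ set X_n := {x ∈ X : |x| < n and dist(x, ℝ^d∖X) > 1/n}. Then the following are equivalent: (i) the operator P(∂) : C^∞(X) → C^∞(X) is surjective (equivalently, X is P-convex for supports); (ii) for every n ∈ ℕ the restriction map C_P^∞(X) → C_P^∞(X_n), f ↦ f|_{X_n}, has dense range, i.e., for every f ∈ C^∞(X_n) with P(∂)f = 0 on X_n, every l ∈ ℕ₀, every compact K ⊆ X_n and every ε > 0 there is g ∈ C^∞(X) with P(∂)g = 0 on X and ‖g|_{X_n} − f‖_{l,K} < ε; (iii) there exists an open, relatively compact exhaustion (Y_n)_{n∈ℕ} of X such that all restriction maps C_P^∞(X) → C_P^∞(Y_n) have dense range in the same sense. -/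
open scoped BigOperators

noncomputable section

/-- Partial derivative in the `i`-th coordinate direction. -/
def pderivE {d : ℕ} {F : Type*} [NormedAddCommGroup F] [NormedSpace ℝ F] (i : Fin d)
    (f : EuclideanSpace ℝ (Fin d) → F) : EuclideanSpace ℝ (Fin d) → F :=
  fun x => fderiv ℝ f x (EuclideanSpace.single i 1)

/-- Iterated partial derivative `∂^α f` for a multi-index `α : Fin d → ℕ`. -/
def mderivE {d : ℕ} {F : Type*} [NormedAddCommGroup F] [NormedSpace ℝ F] (α : Fin d → ℕ)
    (f : EuclideanSpace ℝ (Fin d) → F) : EuclideanSpace ℝ (Fin d) → F :=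
  (List.finRange d).foldr (fun i g => (pderivE i)^[α i] g) f

/-- The seminorm `‖f‖_{l,K} = max_{|α| ≤ l} sup_{x ∈ K} ‖∂^α f (x)‖`. -/
def cSemiNorm {d : ℕ} {F : Type*} [NormedAddCommGroup F] [NormedSpace ℝ F] (l : ℕ)
    (K : Set (EuclideanSpace ℝ (Fin d))) (f : EuclideanSpace ℝ (Fin d) → F) : ℝ :=
  ⨆ α : Fin d → ℕ, ⨆ (_ : (∑ i, α i) ≤ l), ⨆ x ∈ K, ‖mderivE α f x‖

/-- The constant coefficient linear partial differential operator `P(∂)` associated to a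
polynomial `P ∈ ℂ[X_1,…,X_d]`. -/
def PDop {d : ℕ} (P : MvPolynomial (Fin d) ℂ) (f : EuclideanSpace ℝ (Fin d) → ℂ) :
    EuclideanSpace ℝ (Fin d) → ℂ :=
  fun x => ∑ α ∈ P.support, P.coeff α * mderivE (fun i => α i) f x

/-- The canonical exhaustion `X_n = {x ∈ X : |x| < n, dist(x, ℝ^d∖X) > 1/n}`
(with `dist(x, ∅) = ∞`). -/
def exhSet {d : ℕ} (X : Set (EuclideanSpace ℝ (Fin d))) (n : ℕ) :
    Set (EuclideanSpace ℝ (Fin d)) :=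
  {x | x ∈ X ∧ ‖x‖ < (n : ℝ) ∧ ENNReal.ofReal (1 / (n : ℝ)) < EMetric.infEdist x Xᶜ}

/-- The restriction map `C_P^∞(X) → C_P^∞(Y)` has dense range (for the `C^∞`-topology
of `C_P^∞(Y)`). -/
def DenseRestriction {d : ℕ} (P : MvPolynomial (Fin d) ℂ)
    (X Y : Set (EuclideanSpace ℝ (Fin d))) : Prop :=
  ∀ f : EuclideanSpace ℝ (Fin d) → ℂ, ContDiffOn ℝ (⊤ : ℕ∞) f Y → (∀ x ∈ Y, PDop P f x = 0) →
    ∀ l : ℕ, ∀ K : Set (EuclideanSpace ℝ (Fin d)), IsCompact K → K ⊆ Y →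
      ∀ ε : ℝ, 0 < ε →
        ∃ g : EuclideanSpace ℝ (Fin d) → ℂ, ContDiffOn ℝ (⊤ : ℕ∞) g X ∧
          (∀ x ∈ X, PDop P g x = 0) ∧ cSemiNorm l K (fun y => g y - f y) < ε

noncomputable section
namespace PDEaux
open MeasureTheory Set Filter Topology

/-- Short name for the Euclidean space. -/
abbrev EE (d : ℕ) := EuclideanSpace ℝ (Fin d)

/-- Global smoothness. -/
abbrev Smooth {d : ℕ} (f : EE d → ℂ) : Prop := ContDiff ℝ (⊤ : ℕ∞) f

section basics
variable {d : ℕ}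

lemma Smooth.diff {f : EE d → ℂ} (hf : Smooth f) : Differentiable ℝ f :=
  hf.differentiable (by simp)

lemma smooth_pderivE {f : EE d → ℂ} (hf : Smooth f) (i : Fin d) : Smooth (pderivE i f) := by
  have h : ContDiff ℝ (⊤ : ℕ∞) (fderiv ℝ f) := hf.fderiv_right (by simp)
  exact h.clm_apply contDiff_const

lemma pderivE_add {f g : EE d → ℂ} (hf : Smooth f) (hg : Smooth g) (i : Fin d) :
    pderivE i (f + g) = pderivE i f + pderivE i g := by
  funext x
  simp [pderivE, fderiv_add (hf.diff x) (hg.diff x)]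

lemma pderivE_smul {f : EE d → ℂ} (hf : Smooth f) (c : ℂ) (i : Fin d) :
    pderivE i (c • f) = c • pderivE i f := by
  funext x
  simp [pderivE, fderiv_const_smul (hf.diff x) c]

lemma pderivE_mul {f g : EE d → ℂ} (hf : Smooth f) (hg : Smooth g) (i : Fin d) :
    pderivE i (f * g) = f * pderivE i g + pderivE i f * g := by
  funext x
  have := fderiv_mul (hf.diff x) (hg.diff x)
  simp [pderivE, this]
  ring

lemma pderivE_comm {f : EE d → ℂ} (hf : Smooth f) (i j : Fin d) :
    pderivE i (pderivE j f) = pderivE j (pderivE i f) := by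
  funext x
  have h : ContDiff ℝ (⊤ : ℕ∞) (fderiv ℝ f) := hf.fderiv_right (by simp)
  have hd : DifferentiableAt ℝ (fderiv ℝ f) x := h.differentiable (by simp) x
  have hs : IsSymmSndFDerivAt ℝ f x := hf.contDiffAt.isSymmSndFDerivAt
      (by simpa using WithTop.coe_le_coe.2 (le_top : (2 : ℕ∞) ≤ ⊤))
  have key : ∀ v w : EE d, fderiv ℝ (fun y => fderiv ℝ f y v) x w = fderiv ℝ (fderiv ℝ f) x w v := by
    intro v w
    rw [fderiv_clm_apply hd (differentiableAt_const v)]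
    simp
  simp only [pderivE]
  erw [key, key]
  exact hs _ _

/-- Locality of the partial derivatives. -/
lemma pderivE_congr {f g : EE d → ℂ} {x : EE d} (h : f =ᶠ[𝓝 x] g) (i : Fin d) :
    pderivE i f =ᶠ[𝓝 x] pderivE i g := by
  filter_upwards [h.fderiv (𝕜 := ℝ)] with y hy
  simp [pderivE, hy]

lemma mderivE_congr {f g : EE d → ℂ} {x : EE d} (h : f =ᶠ[𝓝 x] g) (α : Fin d → ℕ) :
    mderivE α f =ᶠ[𝓝 x] mderivE α g := by
  unfold mderivE
  induction List.finRange d with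
  | nil => simpa
  | cons a l ih =>
    simp only [List.foldr_cons]
    generalize α a = n
    induction n with
    | zero => simpa
    | succ n ihn =>
      simp only [Function.iterate_succ_apply']
      exact pderivE_congr ihn a

lemma PDop_congr {f g : EE d → ℂ} {x : EE d} (h : f =ᶠ[𝓝 x] g) (P : MvPolynomial (Fin d) ℂ) :
    PDop P f =ᶠ[𝓝 x] PDop P g := by
  unfold PDop
  have : ∀ᶠ y in 𝓝 x, ∀ α ∈ P.support, mderivE (fun i => α i) f y = mderivE (fun i => α i) g y := by
    rw [Filter.eventually_all_finset]
    intro α _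
    exact mderivE_congr h _
  filter_upwards [this] with y hy
  exact Finset.sum_congr rfl fun α hα => by rw [hy α hα]

lemma pderivE_comp_add {f : EE d → ℂ} (a : EE d) (i : Fin d) :
    pderivE i (fun y => f (y + a)) = fun y => pderivE i f (y + a) := by
  funext x
  simp [pderivE, fderiv_comp_add_right]

lemma PDop_comp_add (P : MvPolynomial (Fin d) ℂ) (f : EE d → ℂ) (a : EE d) :
    PDop P (fun y => f (y + a)) = fun y => PDop P f (y + a) := by
  have : ∀ α : Fin d → ℕ, mderivE α (fun y => f (y + a)) = fun y => mderivE α f (y + a) := by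
    intro α
    unfold mderivE
    induction List.finRange d with
    | nil => simp
    | cons b l ih =>
      simp only [List.foldr_cons]
      generalize α b = n
      induction n with
      | zero => simpa
      | succ n ihn =>
        simp only [Function.iterate_succ_apply', ihn]
        exact pderivE_comp_add a b
  funext x
  simp [PDop, this]

lemma pderivE_comp_neg {f : EE d → ℂ} (i : Fin d) :
    pderivE i (fun y => f (-y)) = fun y => - pderivE i f (-y) := by
  funext x
  have h := fderiv_comp_smul (𝕜 := ℝ) (f := f) (c := (-1 : ℝ)) (x := x)
  simp only [neg_smul, one_smul] at h
  simp only [pderivE]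
  rw [h]
  simp

/-- Evaluation of polynomials at commuting endomorphisms. -/
lemma exists_commEval {V : Type*} [AddCommGroup V] [Module ℂ V] (D : Fin d → Module.End ℂ V)
    (h : ∀ i j, D i * D j = D j * D i) :
    ∃ Φ : MvPolynomial (Fin d) ℂ →ₐ[ℂ] Module.End ℂ V, ∀ P, Φ P =
      ∑ α ∈ P.support, P.coeff α • ((List.finRange d).map (fun i => D i ^ α i)).prod := by
  have hc : ∀ a ∈ Set.range D, ∀ b ∈ Set.range D, a * b = b * a := by
    rintro _ ⟨i, rfl⟩ _ ⟨j, rfl⟩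
    exact h i j
  let _ : CommRing (Algebra.adjoin ℂ (Set.range D)) := Algebra.adjoinCommRingOfComm ℂ hc
  let D' : Fin d → Algebra.adjoin ℂ (Set.range D) :=
    fun i => ⟨D i, Algebra.subset_adjoin ⟨i, rfl⟩⟩
  refine ⟨(Algebra.adjoin ℂ (Set.range D)).val.comp (MvPolynomial.aeval D'), fun P => ?_⟩
  rw [AlgHom.comp_apply, MvPolynomial.aeval_def, MvPolynomial.eval₂_eq', map_sum]
  refine Finset.sum_congr rfl fun α _ => ?_
  rw [map_mul, Fin.prod_univ_def, map_list_prod, List.map_map, Algebra.smul_def]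
  congr 1

/-- A space of smooth functions stable under partial derivatives. -/
structure DMod (d : ℕ) where
  /-- the space -/
  V : Submodule ℂ (EE d → ℂ)
  smooth : ∀ f ∈ V, Smooth f
  stable : ∀ f ∈ V, ∀ i, pderivE i f ∈ V

/-- partial derivative as an endomorphism -/
def DMod.D (M : DMod d) (i : Fin d) : Module.End ℂ M.V where
  toFun f := ⟨pderivE i f, M.stable f f.2 i⟩
  map_add' f g := by
    ext1
    exact pderivE_add (M.smooth _ f.2) (M.smooth _ g.2) i
  map_smul' c f := by
    ext1
    exact pderivE_smul (M.smooth _ f.2) c i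

lemma DMod.D_comm (M : DMod d) (i j : Fin d) : M.D i * M.D j = M.D j * M.D i := by
  ext f : 2
  exact pderivE_comm (M.smooth _ f.2) i j

/-- the differential operators as endomorphisms -/
def DMod.Phi (M : DMod d) : MvPolynomial (Fin d) ℂ →ₐ[ℂ] Module.End ℂ M.V :=
  (exists_commEval M.D M.D_comm).choose

lemma DMod.coe_Phi (M : DMod d) (P : MvPolynomial (Fin d) ℂ) (f : M.V) :
    ((M.Phi P f : M.V) : EE d → ℂ) = PDop P f := by
  have := (exists_commEval M.D M.D_comm).choose_spec P
  unfold DMod.Phi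
  rw [this]
  funext x
  simp only [PDop, LinearMap.sum_apply, LinearMap.smul_apply, Submodule.coe_sum, Finset.sum_apply,
    Submodule.coe_smul, Pi.smul_apply, smul_eq_mul]
  refine Finset.sum_congr rfl fun α _ => ?_
  congr 1
  suffices h : ∀ l : List (Fin d), (((l.map (fun i => M.D i ^ α i)).prod f : M.V) : EE d → ℂ) =
      l.foldr (fun i g => (pderivE i)^[α i] g) f by
    rw [h]; rfl
  intro l
  induction l with
  | nil => simp
  | cons a l ih =>
    simp only [List.map_cons, List.prod_cons, List.foldr_cons, ← ih, Module.End.mul_apply]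
    generalize (l.map (fun i => M.D i ^ α i)).prod f = g
    generalize α a = n
    induction n with
    | zero => simp
    | succ n ihn =>
      rw [pow_succ', Function.iterate_succ_apply', ← ihn]
      rfl

/-- all smooth functions -/
def smD (d : ℕ) : DMod d where
  V := { carrier := {f | Smooth f}
         add_mem' := fun {a b} (hf : Smooth a) (hg : Smooth b) => ContDiff.add hf hg
         zero_mem' := (contDiff_const : Smooth fun _ => (0 : ℂ))
         smul_mem' := fun c a (hf : Smooth a) => ContDiff.const_smul c hf }
  smooth := fun _ hf => hf
  stable := fun _ hf i => smooth_pderivE hf i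

lemma pderivE_zero_of_vanish {R : ℝ} {f : EE d → ℂ} (h : ∀ x, R < ‖x‖ → f x = 0) (i : Fin d) :
    ∀ x, R < ‖x‖ → pderivE i f x = 0 := by
  intro x hx
  have : f =ᶠ[𝓝 x] fun _ => 0 := by
    filter_upwards [(isOpen_lt continuous_const continuous_norm).mem_nhds hx] with y hy
    exact h y hy
  have := (pderivE_congr this i).eq_of_nhds
  rw [this]
  simp [pderivE]

/-- smooth functions vanishing off the closed ball of radius `R` -/
def tsD (d : ℕ) (R : ℝ) : DMod d where
  V := { carrier := {f | Smooth f ∧ ∀ x, R < ‖x‖ → f x = 0}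
         add_mem' := fun hf hg => ⟨ContDiff.add hf.1 hg.1, fun x hx => by
          simp [hf.2 x hx, hg.2 x hx]⟩
         zero_mem' := ⟨contDiff_const, fun _ _ => rfl⟩
         smul_mem' := fun c _ hf => ⟨ContDiff.const_smul c hf.1, fun x hx => by
          simp [hf.2 x hx]⟩ }
  smooth := fun _ hf => hf.1
  stable := fun _ hf i => ⟨smooth_pderivE hf.1 i, pderivE_zero_of_vanish hf.2 i⟩

lemma smooth_PDop {f : EE d → ℂ} (hf : Smooth f) (P : MvPolynomial (Fin d) ℂ) :
    Smooth (PDop P f) := by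
  have := (smD d).coe_Phi P ⟨f, hf⟩
  simp only at this
  rw [← this]
  exact ((smD d).Phi P ⟨f, hf⟩).2

lemma PDop_vanish {f : EE d → ℂ} {R : ℝ} (hf : Smooth f) (h : ∀ x, R < ‖x‖ → f x = 0)
    (P : MvPolynomial (Fin d) ℂ) : ∀ x, R < ‖x‖ → PDop P f x = 0 := by
  have := (tsD d R).coe_Phi P ⟨f, hf, h⟩
  simp only at this
  rw [← this]
  exact ((tsD d R).Phi P ⟨f, hf, h⟩).2.2

lemma PDop_add {f g : EE d → ℂ} (hf : Smooth f) (hg : Smooth g) (P : MvPolynomial (Fin d) ℂ) :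
    PDop P (f + g) = PDop P f + PDop P g := by
  have := congrArg Subtype.val (((smD d).Phi P).map_add ⟨f, hf⟩ ⟨g, hg⟩)
  rw [Submodule.coe_add] at this
  simp only [DMod.coe_Phi] at this
  exact this

lemma PDop_smul {f : EE d → ℂ} (hf : Smooth f) (c : ℂ) (P : MvPolynomial (Fin d) ℂ) :
    PDop P (c • f) = c • PDop P f := by
  have := congrArg Subtype.val (((smD d).Phi P).map_smul c ⟨f, hf⟩)
  rw [Submodule.coe_smul] at this
  simp only [DMod.coe_Phi] at this
  exact this

lemma PDop_sub {f g : EE d → ℂ} (hf : Smooth f) (hg : Smooth g) (P : MvPolynomial (Fin d) ℂ) :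
    PDop P (f - g) = PDop P f - PDop P g := by
  have := congrArg Subtype.val (((smD d).Phi P).map_sub ⟨f, hf⟩ ⟨g, hg⟩)
  rw [Submodule.coe_sub] at this
  simp only [DMod.coe_Phi] at this
  exact this

lemma PDop_zero (P : MvPolynomial (Fin d) ℂ) : PDop P (0 : EE d → ℂ) = 0 := by
  have := congrArg Subtype.val (((smD d).Phi P).map_zero)
  simp only [DMod.coe_Phi] at this
  exact this

lemma PDop_mul {f : EE d → ℂ} (hf : Smooth f) (P Q : MvPolynomial (Fin d) ℂ) :
    PDop (P * Q) f = PDop P (PDop Q f) := by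
  have := congrArg (fun T => ((T ⟨f, hf⟩ : (smD d).V) : EE d → ℂ)) (map_mul (smD d).Phi P Q)
  simpa only [DMod.coe_Phi, Module.End.mul_apply] using this

lemma PDop_polyadd {f : EE d → ℂ} (hf : Smooth f) (P Q : MvPolynomial (Fin d) ℂ) :
    PDop (P + Q) f = PDop P f + PDop Q f := by
  have := congrArg (fun T => ((T ⟨f, hf⟩ : (smD d).V) : EE d → ℂ)) (map_add (smD d).Phi P Q)
  simpa only [DMod.coe_Phi, LinearMap.add_apply, Submodule.coe_add] using this

lemma PDop_monomial (α : Fin d →₀ ℕ) (f : EE d → ℂ) :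
    PDop (MvPolynomial.monomial α 1) f = mderivE (fun i => α i) f := by
  funext x
  simp [PDop, MvPolynomial.support_monomial]

lemma mderivE_eq (α : Fin d → ℕ) (f : EE d → ℂ) :
    mderivE α f = PDop (MvPolynomial.monomial (Finsupp.equivFunOnFinite.symm α) 1) f := by
  rw [PDop_monomial]
  rfl

lemma mderivE_zero_idx (f : EE d → ℂ) : mderivE (fun _ => 0) f = f := by
  unfold mderivE
  induction List.finRange d with
  | nil => simp
  | cons a l ih => simp [ih]

lemma PDop_C (a : ℂ) (f : EE d → ℂ) : PDop (MvPolynomial.C a) f = a • f := by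
  funext x
  by_cases h : a = 0
  · simp [PDop, h]
  · have := MvPolynomial.support_monomial (s := (0 : Fin d →₀ ℕ)) (a := a)
    rw [if_neg h] at this
    rw [MvPolynomial.C_apply]
    unfold PDop
    rw [this, Finset.sum_singleton, MvPolynomial.coeff_monomial, if_pos rfl]
    exact congrArg (fun z => a * z) (congrFun (mderivE_zero_idx f) x)

lemma coe_Phi_X (M : DMod d) (i : Fin d) (f : M.V) :
    ((M.Phi (MvPolynomial.X i) f : M.V) : EE d → ℂ) = pderivE i f := by
  rw [DMod.coe_Phi]
  have : ∀ f : EE d → ℂ, ∀ l : List (Fin d), l.Nodup →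
    l.foldr (fun j g => (pderivE j)^[(Finsupp.single i 1 : Fin d →₀ ℕ) j] g) f =
      if i ∈ l then pderivE i f else f := by
    intro f l hl
    induction l with
    | nil => simp
    | cons a l ih =>
      simp only [List.nodup_cons] at hl
      rw [List.foldr_cons, ih hl.2]
      by_cases h : i = a
      · subst h
        simp [hl.1]
      · have h' : (Finsupp.single i 1 : Fin d →₀ ℕ) a = 0 := by simp [h]
        simp [h', h]
  have h2 := this f (List.finRange d) (List.nodup_finRange d)
  rw [MvPolynomial.X, PDop_monomial]
  unfold mderivE
  rw [h2]
  simp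

lemma PDop_X {f : EE d → ℂ} (hf : Smooth f) (i : Fin d) :
    PDop (MvPolynomial.X i) f = pderivE i f := by
  have := coe_Phi_X (smD d) i ⟨f, hf⟩
  rwa [DMod.coe_Phi] at this

end basics
end PDEaux
end

noncomputable section
namespace PDEaux
open MeasureTheory Set Filter Topology

section hormander
variable {d : ℕ}

lemma hcs_of_vanish {R : ℝ} {f : EE d → ℂ} (h : ∀ x, R < ‖x‖ → f x = 0) : HasCompactSupport f :=
  HasCompactSupport.intro (isCompact_closedBall (0 : EE d) R) fun x hx => h x (by
    simpa using hx)

lemma vanish_of_hcs {f : EE d → ℂ} (h : HasCompactSupport f) :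
    ∃ R : ℝ, 0 < R ∧ ∀ x, R < ‖x‖ → f x = 0 := by
  obtain ⟨R, hR⟩ := (h.isCompact.isBounded).subset_closedBall (0 : EE d)
  refine ⟨max R 1, by positivity, fun x hx => ?_⟩
  by_contra hne
  have := hR (subset_tsupport f hne)
  simp at this
  exact absurd hx (by simp [this])

lemma hcs_pderivE {f : EE d → ℂ} (h : HasCompactSupport f) (i : Fin d) :
    HasCompactSupport (pderivE i f) := by
  obtain ⟨R, -, hR⟩ := vanish_of_hcs h
  exact hcs_of_vanish (pderivE_zero_of_vanish hR i)

lemma hcs_PDop {f : EE d → ℂ} (hs : Smooth f) (h : HasCompactSupport f)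
    (P : MvPolynomial (Fin d) ℂ) : HasCompactSupport (PDop P f) := by
  obtain ⟨R, -, hR⟩ := vanish_of_hcs h
  exact hcs_of_vanish (PDop_vanish hs hR P)

/-- Integration by parts. -/
lemma ibp {f g : EE d → ℂ} (hf : Smooth f) (hg : Smooth g) (hc : HasCompactSupport f)
    (i : Fin d) : ∫ x, f x * pderivE i g x = - ∫ x, pderivE i f x * g x := by
  have h1 : Integrable (fun x => pderivE i f x * g x) :=
    Continuous.integrable_of_hasCompactSupport
      ((smooth_pderivE hf i).continuous.mul hg.continuous) ((hcs_pderivE hc i).mul_right)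
  have h2 : Integrable (fun x => f x * pderivE i g x) :=
    Continuous.integrable_of_hasCompactSupport
      (hf.continuous.mul (smooth_pderivE hg i).continuous) (hc.mul_right)
  have h3 : Integrable (fun x => f x * g x) :=
    Continuous.integrable_of_hasCompactSupport
      (hf.continuous.mul hg.continuous) (hc.mul_right)
  exact integral_mul_fderiv_eq_neg_fderiv_mul_of_integrable h1 h2 h3
    (fun x _ => hf.diff x) (fun x _ => hg.diff x)

/-- degree bound -/
def degLe (P : MvPolynomial (Fin d) ℂ) (m : ℕ) : Prop :=
  ∀ α : Fin d →₀ ℕ, m < α.degree → P.coeff α = 0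

lemma degLe_pderiv {P : MvPolynomial (Fin d) ℂ} {m : ℕ} (h : degLe P (m + 1)) (j : Fin d) :
    degLe (MvPolynomial.pderiv j P) m := by
  intro α hα
  rw [MvPolynomial.coeff_pderiv, h, zero_mul]
  simpa using hα

lemma exists_degLe (P : MvPolynomial (Fin d) ℂ) : ∃ m, degLe P m := by
  refine ⟨P.support.sup Finsupp.degree, fun α hα => ?_⟩
  by_contra hne
  exact absurd hα (not_lt.2 (Finset.le_sup (f := Finsupp.degree)
    (MvPolynomial.mem_support_iff.2 hne)))

lemma eq_C_of_pderiv {P : MvPolynomial (Fin d) ℂ} (h : ∀ j, MvPolynomial.pderiv j P = 0) :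
    P = MvPolynomial.C (P.coeff 0) := by
  ext α
  rw [MvPolynomial.coeff_C]
  split_ifs with h0
  · rw [h0]
  · have : ∃ j, α j ≠ 0 := by
      by_contra hc
      push Not at hc
      exact h0 (by ext j; simp [hc j])
    obtain ⟨j, hj⟩ := this
    have h1 := congrArg (MvPolynomial.coeff (α - Finsupp.single j 1)) (h j)
    have h2 : α - Finsupp.single j 1 + Finsupp.single j 1 = α :=
      tsub_add_cancel_of_le (by
        rw [Finsupp.single_le_iff]; omega)
    rw [MvPolynomial.coeff_pderiv, h2, MvPolynomial.coeff_zero] at h1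
    rcases mul_eq_zero.1 h1 with h3 | h3
    · exact h3
    · exfalso
      exact Nat.cast_add_one_ne_zero _ h3

/-- Data for the abstract Hörmander inequality. -/
structure HData (d : ℕ) (R : ℝ) where
  /-- functions -/
  V : Type
  [i1 : AddCommGroup V]
  [i2 : Module ℂ V]
  /-- Hilbert space -/
  H : Type
  [i3 : NormedAddCommGroup H]
  [i4 : InnerProductSpace ℂ H]
  /-- embedding -/
  ι : V →ₗ[ℂ] H
  /-- operators -/
  Φ : MvPolynomial (Fin d) ℂ →ₐ[ℂ] Module.End ℂ V
  /-- multiplication -/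
  X : Fin d → V → V
  /-- adjoint -/
  s : MvPolynomial (Fin d) ℂ → MvPolynomial (Fin d) ℂ
  hadj : ∀ P φ ψ, inner ℂ (ι (Φ P φ)) (ι ψ) = inner ℂ (ι φ) (ι (Φ (s P) ψ))
  hcomm : ∀ P j φ, Φ P (X j φ) = X j (Φ P φ) + Φ (MvPolynomial.pderiv j P) φ
  hs : ∀ P j, MvPolynomial.pderiv j (s P) = - s (MvPolynomial.pderiv j P)
  hR : ∀ j φ, ‖ι (X j φ)‖ ≤ R * ‖ι φ‖

attribute [instance] HData.i1 HData.i2 HData.i3 HData.i4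

namespace HData
variable {R : ℝ} (S : HData d R)

lemma hadj' (P : MvPolynomial (Fin d) ℂ) (φ ψ : S.V) :
    inner ℂ (S.ι φ) (S.ι (S.Φ P ψ)) = inner ℂ (S.ι (S.Φ (S.s P) φ)) (S.ι ψ) := by
  rw [← inner_conj_symm, S.hadj, inner_conj_symm]

lemma swap (P Q : MvPolynomial (Fin d) ℂ) (φ : S.V) : S.Φ P (S.Φ Q φ) = S.Φ Q (S.Φ P φ) := by
  rw [← Module.End.mul_apply, ← Module.End.mul_apply, ← map_mul, ← map_mul, mul_comm]

lemma norm_s (P : MvPolynomial (Fin d) ℂ) (φ : S.V) :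
    ‖S.ι (S.Φ (S.s P) φ)‖ = ‖S.ι (S.Φ P φ)‖ := by
  have h : inner ℂ (S.ι (S.Φ (S.s P) φ)) (S.ι (S.Φ (S.s P) φ)) =
      inner ℂ (S.ι (S.Φ P φ)) (S.ι (S.Φ P φ)) := by
    rw [← S.hadj', S.hadj, S.swap]
  rw [inner_self_eq_norm_sq_to_K, inner_self_eq_norm_sq_to_K] at h
  have h' : ‖S.ι (S.Φ (S.s P) φ)‖ ^ 2 = ‖S.ι (S.Φ P φ)‖ ^ 2 := by exact_mod_cast h
  exact (sq_eq_sq₀ (norm_nonneg _) (norm_nonneg _)).1 h'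

lemma step (hR0 : 0 ≤ R) (m : ℕ) : ∀ P : MvPolynomial (Fin d) ℂ, degLe P m → ∀ j φ,
    ‖S.ι (S.Φ (MvPolynomial.pderiv j P) φ)‖ ≤ 2 * m * R * ‖S.ι (S.Φ P φ)‖ := by
  induction m with
  | zero =>
    intro P hP j φ
    have : MvPolynomial.pderiv j P = 0 := by
      ext α
      rw [MvPolynomial.coeff_pderiv, hP, zero_mul, MvPolynomial.coeff_zero]
      simp
    simp [this]
  | succ m ih =>
    intro P hP j φ
    set P' := MvPolynomial.pderiv j P with hP'
    have ih' := ih P' (degLe_pderiv hP j) j φ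
    set P'' := MvPolynomial.pderiv j P' with hP''
    have e1 : S.ι (S.Φ P' φ) = S.ι (S.Φ P (S.X j φ)) - S.ι (S.X j (S.Φ P φ)) := by
      rw [S.hcomm, map_add, add_sub_cancel_left]
    have e2 : inner ℂ (S.ι (S.Φ P' φ)) (S.ι (S.Φ P (S.X j φ))) =
        inner ℂ (S.ι (S.Φ (S.s P) φ)) (S.ι (S.X j (S.Φ (S.s P') φ)))
        - inner ℂ (S.ι (S.Φ (S.s P) φ)) (S.ι (S.Φ (S.s P'') φ)) := by
      rw [S.hadj', S.swap, S.hadj, S.hcomm, S.hs, map_neg, LinearMap.neg_apply, map_add,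
        inner_add_right, map_neg, inner_neg_right, sub_eq_add_neg]
    have e3 : (‖S.ι (S.Φ P' φ)‖ : ℝ) ^ 2 ≤
        ‖S.ι (S.Φ P φ)‖ * (R * ‖S.ι (S.Φ P' φ)‖) + ‖S.ι (S.Φ P φ)‖ * ‖S.ι (S.Φ P'' φ)‖
        + ‖S.ι (S.Φ P' φ)‖ * (R * ‖S.ι (S.Φ P φ)‖) := by
      have h0 : inner ℂ (S.ι (S.Φ P' φ)) (S.ι (S.Φ P' φ)) =
        inner ℂ (S.ι (S.Φ (S.s P) φ)) (S.ι (S.X j (S.Φ (S.s P') φ)))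
        - inner ℂ (S.ι (S.Φ (S.s P) φ)) (S.ι (S.Φ (S.s P'') φ))
        - inner ℂ (S.ι (S.Φ P' φ)) (S.ι (S.X j (S.Φ P φ))) := by
        rw [← e2, ← inner_sub_right, ← e1]
      have h1 : (‖S.ι (S.Φ P' φ)‖ : ℝ) ^ 2 = ‖inner ℂ (S.ι (S.Φ P' φ)) (S.ι (S.Φ P' φ))‖ := by
        rw [inner_self_eq_norm_sq_to_K]
        simp
      rw [h1, h0]
      refine (norm_sub_le _ _).trans (add_le_add ((norm_sub_le _ _).trans (add_le_add ?_ ?_)) ?_)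
      · refine (norm_inner_le_norm _ _).trans ?_
        rw [S.norm_s]
        gcongr
        refine (S.hR _ _).trans ?_
        rw [S.norm_s]
      · refine (norm_inner_le_norm _ _).trans ?_
        rw [S.norm_s, S.norm_s]
      · refine (norm_inner_le_norm _ _).trans ?_
        gcongr
        exact S.hR _ _
    rcases (norm_nonneg (S.ι (S.Φ P' φ))).eq_or_lt with h | h
    · rw [← h]; positivity
    · have hp := norm_nonneg (S.ι (S.Φ P φ))
      have h4 := mul_le_mul_of_nonneg_left ih' hp
      push_cast
      nlinarith

end HData

theorem hormander {R : ℝ} (hR0 : 0 ≤ R) (P : MvPolynomial (Fin d) ℂ) (hP : P ≠ 0) :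
    ∃ C : ℝ, 0 < C ∧ ∀ (S : HData d R) (φ : S.V), ‖S.ι φ‖ ≤ C * ‖S.ι (S.Φ P φ)‖ := by
  have hconst : ∀ P : MvPolynomial (Fin d) ℂ, P ≠ 0 → (∀ j, MvPolynomial.pderiv j P = 0) →
      ∃ C : ℝ, 0 < C ∧ ∀ (S : HData d R) (φ : S.V), ‖S.ι φ‖ ≤ C * ‖S.ι (S.Φ P φ)‖ := by
    intro P hP h
    have h1 := eq_C_of_pderiv h
    set a := P.coeff 0
    have ha : a ≠ 0 := by
      intro h0
      rw [h0, map_zero] at h1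
      exact hP h1
    have ha' : 0 < ‖a‖ := norm_pos_iff.2 ha
    refine ⟨‖a‖⁻¹, by positivity, fun S φ => ?_⟩
    have h2 : S.Φ P φ = a • φ := by
      rw [h1, ← MvPolynomial.algebraMap_eq, AlgHom.commutes, Module.algebraMap_end_apply]
    rw [h2, map_smul, norm_smul, inv_mul_cancel_left₀ ha'.ne']
  obtain ⟨m, hm⟩ := exists_degLe P
  induction m generalizing P with
  | zero =>
    refine hconst P hP fun j => ?_
    ext α
    rw [MvPolynomial.coeff_pderiv, hm, zero_mul, MvPolynomial.coeff_zero]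
    simp
  | succ m ih =>
    by_cases h : ∀ j, MvPolynomial.pderiv j P = 0
    · exact hconst P hP h
    · push Not at h
      obtain ⟨j, hj⟩ := h
      obtain ⟨C, hC, hC'⟩ := ih _ hj (degLe_pderiv hm j)
      refine ⟨C * (2 * (m + 1) * R) + 1, by positivity, fun S φ => ?_⟩
      have h1 := hC' S φ
      have h2 := S.step hR0 (m + 1) P hm j φ
      have h3 := mul_le_mul_of_nonneg_left h2 hC.le
      push_cast at h3
      have := norm_nonneg (S.ι (S.Φ P φ))
      nlinarith

end hormander
end PDEaux
end

noncomputable section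
namespace PDEaux
open MeasureTheory Set Filter Topology

section concrete
variable {d : ℕ}

/-- the weight -/
def wt (a : EE d) (x : EE d) : ℂ := (Real.exp (inner ℝ a x) : ℂ)

lemma smooth_wt (a : EE d) : Smooth (wt a) := by
  unfold wt
  have h : ContDiff ℝ (⊤ : ℕ∞) (fun x : EE d => Real.exp (inner ℝ a x)) :=
    (contDiff_const.inner ℝ contDiff_id).exp
  exact Complex.ofRealCLM.contDiff.comp h

lemma pderivE_wt (a : EE d) (i : Fin d) : pderivE i (wt a) = (a i : ℂ) • wt a := by
  funext x
  have h1 : HasFDerivAt (fun x : EE d => inner ℝ a x) (innerSL ℝ a) x :=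
    (innerSL ℝ a).hasFDerivAt
  have h2 := Complex.ofRealCLM.hasFDerivAt.comp x h1.exp
  have h3 : HasFDerivAt (wt a) _ x := h2
  simp only [pderivE]
  rw [h3.fderiv]
  simp [wt, EuclideanSpace.inner_single_right]
  ring

lemma memLp_of_ts {R : ℝ} {f : EE d → ℂ} (hf : Continuous f) (h : ∀ x, R < ‖x‖ → f x = 0) :
    MemLp f 2 (volume : Measure (EE d)) :=
  hf.memLp_of_hasCompactSupport (hcs_of_vanish h)

lemma memLp_wt {R : ℝ} (a : EE d) (φ : (tsD d R).V) :
    MemLp (fun x => wt a x * (φ : EE d → ℂ) x) 2 (volume : Measure (EE d)) :=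
  memLp_of_ts (R := R) ((smooth_wt a).continuous.mul φ.2.1.continuous)
    (fun x hx => by rw [φ.2.2 x hx, mul_zero])

/-- weighted embedding in `L²` -/
def iotaW (R : ℝ) (a : EE d) : (tsD d R).V →ₗ[ℂ] Lp ℂ 2 (volume : Measure (EE d)) where
  toFun φ := (memLp_wt a φ).toLp
  map_add' φ ψ := by
    rw [← MemLp.toLp_add]
    congr 1
    funext x
    simp [mul_add]
  map_smul' c φ := by
    rw [RingHom.id_apply, ← MemLp.toLp_const_smul]
    congr 1
    funext x
    simp
    ring

lemma inner_iotaW {R : ℝ} (a : EE d) (φ ψ : (tsD d R).V) :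
    inner ℂ (iotaW R a φ) (iotaW R a ψ) =
      ∫ x, (starRingEnd ℂ) ((φ : EE d → ℂ) x) * ((ψ : EE d → ℂ) x * wt ((2 : ℝ) • a) x) := by
  rw [L2.inner_def]
  refine integral_congr_ae ?_
  filter_upwards [(memLp_wt a φ).coeFn_toLp, (memLp_wt a ψ).coeFn_toLp] with x h1 h2
  have h1' : (iotaW R a φ : EE d → ℂ) x = _ := h1
  have h2' : (iotaW R a ψ : EE d → ℂ) x = _ := h2
  rw [h1', h2']
  have h3 : wt ((2 : ℝ) • a) x = wt a x * wt a x := by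
    simp only [wt]
    rw [← Complex.ofReal_mul, ← Real.exp_add, inner_smul_left]
    congr 2
    simp
    ring
  have h4 : (starRingEnd ℂ) (wt a x) = wt a x := Complex.conj_ofReal _
  rw [h3]
  simp only [RCLike.inner_apply, map_mul, h4]
  ring

lemma smooth_conj {f : EE d → ℂ} (hf : Smooth f) : Smooth (fun x => (starRingEnd ℂ) (f x)) :=
  Complex.conjCLE.contDiff.comp hf

lemma pderivE_conj {f : EE d → ℂ} (hf : Smooth f) (i : Fin d) :
    pderivE i (fun x => (starRingEnd ℂ) (f x)) = fun x => (starRingEnd ℂ) (pderivE i f x) := by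
  funext x
  have h := (Complex.conjCLE : ℂ →L[ℝ] ℂ).hasFDerivAt.comp x (hf.diff x).hasFDerivAt
  have h' : HasFDerivAt (fun x => (starRingEnd ℂ) (f x)) _ x := h
  simp only [pderivE]
  rw [h'.fderiv]
  simp

/-- formal adjoint -/
def adjP (a : EE d) (P : MvPolynomial (Fin d) ℂ) : MvPolynomial (Fin d) ℂ :=
  MvPolynomial.aeval (fun j => -(MvPolynomial.X j + MvPolynomial.C ((2 * a j : ℝ) : ℂ)))
    (MvPolynomial.map (starRingEnd ℂ) P)

lemma pderiv_adjP (a : EE d) (P : MvPolynomial (Fin d) ℂ) (j : Fin d) :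
    MvPolynomial.pderiv j (adjP a P) = - adjP a (MvPolynomial.pderiv j P) := by
  induction P using MvPolynomial.induction_on with
  | C c => simp [adjP, ← MvPolynomial.algebraMap_eq]
  | add p q hp hq =>
    simp only [adjP, map_add] at *
    rw [hp, hq]; ring
  | mul_X p i hp =>
    simp only [adjP, map_mul, MvPolynomial.map_X, MvPolynomial.aeval_X, MvPolynomial.pderiv_mul,
      map_add, map_neg, MvPolynomial.pderiv_C] at *
    rw [hp]
    by_cases h : i = j
    · subst h
      simp
      ring
    · simp [MvPolynomial.pderiv_X_of_ne h]

lemma adj_iotaW {R : ℝ} (a : EE d) (P : MvPolynomial (Fin d) ℂ) : ∀ (φ ψ : (tsD d R).V),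
    inner ℂ (iotaW R a ((tsD d R).Phi P φ)) (iotaW R a ψ) =
      inner ℂ (iotaW R a φ) (iotaW R a ((tsD d R).Phi (adjP a P) ψ)) := by
  induction P using MvPolynomial.induction_on with
  | C c =>
    intro φ ψ
    have h1 : (tsD d R).Phi (MvPolynomial.C c) φ = c • φ := by
      rw [← MvPolynomial.algebraMap_eq, AlgHom.commutes, Module.algebraMap_end_apply]
    have h2 : (tsD d R).Phi (adjP a (MvPolynomial.C c)) ψ = (starRingEnd ℂ) c • ψ := by
      rw [adjP, MvPolynomial.map_C, MvPolynomial.aeval_C, AlgHom.commutes,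
        Module.algebraMap_end_apply]
    rw [h1, h2, map_smul, map_smul, inner_smul_left, inner_smul_right]
  | add p q hp hq =>
    intro φ ψ
    have : adjP a (p + q) = adjP a p + adjP a q := by simp [adjP]
    rw [this, map_add, map_add, LinearMap.add_apply, LinearMap.add_apply, map_add, map_add,
      inner_add_left, inner_add_right, hp, hq]
  | mul_X p i hp =>
    intro φ ψ
    have h0 : adjP a (p * MvPolynomial.X i) =
      (-(MvPolynomial.X i + MvPolynomial.C ((2 * a i : ℝ) : ℂ))) * adjP a p := by
      simp only [adjP, map_mul, MvPolynomial.map_X, MvPolynomial.aeval_X]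
      ring
    rw [h0, map_mul, map_mul, Module.End.mul_apply, Module.End.mul_apply, hp]
    set χ := (tsD d R).Phi (adjP a p) ψ
    rw [inner_iotaW, inner_iotaW]
    rw [coe_Phi_X]
    have hχ : (((tsD d R).Phi (-(MvPolynomial.X i + MvPolynomial.C ((2 * a i : ℝ) : ℂ))) χ :
        (tsD d R).V) : EE d → ℂ) =
        fun x => -(pderivE i (χ : EE d → ℂ) x + ((2 * a i : ℝ) : ℂ) * (χ : EE d → ℂ) x) := by
      rw [map_neg, map_add, LinearMap.neg_apply, LinearMap.add_apply, ← MvPolynomial.algebraMap_eq,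
        AlgHom.commutes, Module.algebraMap_end_apply, Submodule.coe_neg, Submodule.coe_add,
        coe_Phi_X]
      rfl
    rw [hχ]
    have hφs : Smooth (φ : EE d → ℂ) := φ.2.1
    have hχs : Smooth (χ : EE d → ℂ) := χ.2.1
    have hcs : HasCompactSupport (fun x => (starRingEnd ℂ) ((φ : EE d → ℂ) x)) :=
      hcs_of_vanish (R := R) fun x hx => by rw [φ.2.2 x hx, map_zero]
    have key := ibp (smooth_conj hφs) (hχs.mul (smooth_wt ((2 : ℝ) • a))) hcs i
    rw [pderivE_conj hφs] at key
    rw [← neg_eq_iff_eq_neg] at key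
    have e := pderivE_mul hχs (smooth_wt ((2 : ℝ) • a)) i
    have e' : pderivE i (fun x => (χ : EE d → ℂ) x * wt ((2 : ℝ) • a) x) = _ := e
    rw [← key, e', pderivE_wt, ← integral_neg]
    refine integral_congr_ae (Eventually.of_forall fun x => ?_)
    simp
    ring

/-- coordinate function -/
def coordF (j : Fin d) (x : EE d) : ℂ := ((x j : ℝ) : ℂ)

lemma smooth_coordF (j : Fin d) : Smooth (coordF (d := d) j) := by
  have : ContDiff ℝ (⊤ : ℕ∞) (fun x : EE d => x j) :=
    (EuclideanSpace.proj j : EE d →L[ℝ] ℝ).contDiff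
  exact Complex.ofRealCLM.contDiff.comp this

lemma pderivE_coordF (i j : Fin d) :
    pderivE i (coordF (d := d) j) = fun _ => if j = i then 1 else 0 := by
  funext x
  have h := (Complex.ofRealCLM.comp
    (EuclideanSpace.proj j : EE d →L[ℝ] ℝ)).hasFDerivAt (x := x)
  have h' : HasFDerivAt (coordF (d := d) j) _ x := h
  simp only [pderivE]
  rw [h'.fderiv]
  simp
  split_ifs <;> simp

/-- multiplication by a coordinate -/
def mulX (R : ℝ) (j : Fin d) (φ : (tsD d R).V) : (tsD d R).V :=
  ⟨fun x => coordF j x * (φ : EE d → ℂ) x, (smooth_coordF j).mul φ.2.1, fun x hx => by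
    simp [φ.2.2 x hx]⟩

lemma Phi_mulX {R : ℝ} (P : MvPolynomial (Fin d) ℂ) : ∀ (j : Fin d) (φ : (tsD d R).V),
    (tsD d R).Phi P (mulX R j φ) =
      mulX R j ((tsD d R).Phi P φ) + (tsD d R).Phi (MvPolynomial.pderiv j P) φ := by
  have hadd : ∀ j (φ ψ : (tsD d R).V), mulX R j (φ + ψ) = mulX R j φ + mulX R j ψ := by
    intro j φ ψ
    ext x
    simp [mulX, mul_add]
  induction P using MvPolynomial.induction_on with
  | C c =>
    intro j φ
    rw [MvPolynomial.pderiv_C, map_zero, LinearMap.zero_apply, add_zero,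
      ← MvPolynomial.algebraMap_eq, AlgHom.commutes, Module.algebraMap_end_apply,
      Module.algebraMap_end_apply]
    ext x
    simp [mulX]
    ring
  | add p q hp hq =>
    intro j φ
    rw [map_add, map_add, map_add, LinearMap.add_apply, LinearMap.add_apply, LinearMap.add_apply,
      hp, hq, hadd]
    abel
  | mul_X p i hp =>
    intro j φ
    have h1 : (tsD d R).Phi (MvPolynomial.X i) (mulX R j φ) =
        mulX R j ((tsD d R).Phi (MvPolynomial.X i) φ) + (if j = i then (1 : ℂ) else 0) • φ := by
      ext1
      rw [coe_Phi_X, Submodule.coe_add, Submodule.coe_smul]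
      have e := pderivE_mul (smooth_coordF j) φ.2.1 i
      have e' : pderivE i ((mulX R j φ : (tsD d R).V) : EE d → ℂ) = _ := e
      rw [e', pderivE_coordF]
      funext x
      simp [mulX, coe_Phi_X]
      split_ifs <;> simp
    rw [map_mul, Module.End.mul_apply, h1, map_add, hp, map_smul, Module.End.mul_apply,
      MvPolynomial.pderiv_mul, map_add, LinearMap.add_apply, map_mul, Module.End.mul_apply]
    by_cases h : j = i
    · subst h
      simp [add_assoc]
    · simp [h, MvPolynomial.pderiv_X_of_ne (Ne.symm h)]

lemma norm_mulX {R : ℝ} (hR : 0 ≤ R) (a : EE d) (j : Fin d) (φ : (tsD d R).V) :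
    ‖iotaW R a (mulX R j φ)‖ ≤ R * ‖iotaW R a φ‖ := by
  refine Lp.norm_le_mul_norm_of_ae_le_mul ?_
  filter_upwards [(memLp_wt a φ).coeFn_toLp, (memLp_wt a (mulX R j φ)).coeFn_toLp] with x h1 h2
  have h1' : (iotaW R a φ : EE d → ℂ) x = _ := h1
  have h2' : (iotaW R a (mulX R j φ) : EE d → ℂ) x = _ := h2
  rw [h1', h2']
  by_cases hx : R < ‖x‖
  · simp [mulX, φ.2.2 x hx]
  · have h3 : ‖coordF j x‖ ≤ R := by
      simp only [coordF, Complex.norm_real]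
      exact (PiLp.norm_apply_le x j).trans (not_lt.1 hx)
    simp only [mulX, norm_mul]
    have h4 := mul_le_mul_of_nonneg_right h3
      (mul_nonneg (norm_nonneg (wt a x)) (norm_nonneg ((φ : EE d → ℂ) x)))
    linarith

/-- concrete data -/
def hdata (R : ℝ) (hR : 0 ≤ R) (a : EE d) : HData d R where
  V := (tsD d R).V
  H := Lp ℂ 2 (volume : Measure (EE d))
  ι := iotaW R a
  Φ := (tsD d R).Phi
  X := mulX R
  s := adjP a
  hadj := adj_iotaW a
  hcomm := Phi_mulX
  hs := pderiv_adjP a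
  hR := norm_mulX hR a

theorem hormanderW {R : ℝ} (hR : 0 ≤ R) (P : MvPolynomial (Fin d) ℂ) (hP : P ≠ 0) :
    ∃ C : ℝ, 0 < C ∧ ∀ (a : EE d) (φ : (tsD d R).V),
      ‖iotaW R a φ‖ ≤ C * ‖iotaW R a ((tsD d R).Phi P φ)‖ := by
  obtain ⟨C, hC, h⟩ := hormander hR P hP
  exact ⟨C, hC, fun a φ => h (hdata R hR a) φ⟩

end concrete
end PDEaux
end

noncomputable section
namespace PDEaux
open MeasureTheory Set Filter Topology
section conv
variable {d : ℕ}

/-- the polynomial `P(-X)` -/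
def negP (P : MvPolynomial (Fin d) ℂ) : MvPolynomial (Fin d) ℂ :=
  MvPolynomial.aeval (fun i => -MvPolynomial.X i) P

lemma negP_add (P Q : MvPolynomial (Fin d) ℂ) : negP (P + Q) = negP P + negP Q := map_add _ _ _
lemma negP_mul (P Q : MvPolynomial (Fin d) ℂ) : negP (P * Q) = negP P * negP Q := map_mul _ _ _
lemma negP_C (c : ℂ) : negP (MvPolynomial.C c : MvPolynomial (Fin d) ℂ) = MvPolynomial.C c := by
  simp [negP, ← MvPolynomial.algebraMap_eq]
lemma negP_X (i : Fin d) : negP (MvPolynomial.X i) = -MvPolynomial.X i := by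
  simp [negP]
lemma negP_neg (P : MvPolynomial (Fin d) ℂ) : negP (-P) = -negP P := map_neg _ _

lemma negP_negP (P : MvPolynomial (Fin d) ℂ) : negP (negP P) = P := by
  induction P using MvPolynomial.induction_on with
  | C c => rw [negP_C, negP_C]
  | add p q hp hq => rw [negP_add, negP_add, hp, hq]
  | mul_X p i hp => rw [negP_mul, negP_mul, hp, negP_X, negP_neg, negP_X, neg_neg]

lemma negP_ne_zero {P : MvPolynomial (Fin d) ℂ} (h : P ≠ 0) : negP P ≠ 0 := by
  intro h0
  apply h
  rw [← negP_negP P, h0]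
  exact map_zero _

lemma PDop_neg_poly {f : EE d → ℂ} (hf : Smooth f) (P : MvPolynomial (Fin d) ℂ) :
    PDop (-P) f = - PDop P f := by
  have h : (-P) = MvPolynomial.C (-1) * P := by simp
  rw [h, PDop_mul hf, PDop_C]
  simp

lemma PDop_comm {f : EE d → ℂ} (hf : Smooth f) (P Q : MvPolynomial (Fin d) ℂ) :
    PDop P (PDop Q f) = PDop Q (PDop P f) := by
  rw [← PDop_mul hf, mul_comm, PDop_mul hf]

lemma ibpP {φ : EE d → ℂ} (P : MvPolynomial (Fin d) ℂ) :
    ∀ {f : EE d → ℂ}, Smooth f → Smooth φ → HasCompactSupport φ →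
    ∫ x, f x * PDop P φ x = ∫ x, PDop (negP P) f x * φ x := by
  induction P using MvPolynomial.induction_on generalizing φ with
  | C c =>
    intro f hf hφ hc
    rw [negP_C, PDop_C, PDop_C]
    refine integral_congr_ae (Eventually.of_forall fun x => ?_)
    simp
    ring
  | add p q hp hq =>
    intro f hf hφ hc
    rw [negP_add, PDop_polyadd hφ, PDop_polyadd hf]
    simp only [Pi.add_apply, mul_add, add_mul]
    rw [integral_add, integral_add, hp hf hφ hc, hq hf hφ hc]
    · exact ((smooth_PDop hf _).continuous.mul hφ.continuous).integrable_of_hasCompactSupport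
        (hc.mul_left)
    · exact ((smooth_PDop hf _).continuous.mul hφ.continuous).integrable_of_hasCompactSupport
        (hc.mul_left)
    · exact (hf.continuous.mul (smooth_PDop hφ _).continuous).integrable_of_hasCompactSupport
        ((hcs_PDop hφ hc _).mul_left)
    · exact (hf.continuous.mul (smooth_PDop hφ _).continuous).integrable_of_hasCompactSupport
        ((hcs_PDop hφ hc _).mul_left)
  | mul_X p i hp =>
    intro f hf hφ hc
    rw [PDop_mul hφ, PDop_X hφ, hp hf (smooth_pderivE hφ i) (hcs_pderivE hc i), negP_mul, negP_X,
      mul_neg, PDop_neg_poly hf, mul_comm, PDop_mul hf, PDop_X (smooth_PDop hf _)]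
    have := ibp hφ (smooth_PDop hf (negP p)) hc i
    simp only [Pi.neg_apply, neg_mul, integral_neg]
    rw [show (fun x => PDop (negP p) f x * pderivE i φ x) =
      fun x => pderivE i φ x * PDop (negP p) f x from funext fun x => mul_comm _ _,
      ← neg_eq_iff_eq_neg, ← this]
    exact integral_congr_ae (Eventually.of_forall fun x => mul_comm _ _)

lemma ibpP' {φ f : EE d → ℂ} (P : MvPolynomial (Fin d) ℂ) (hf : Smooth f) (hφ : Smooth φ)
    (hc : HasCompactSupport φ) :
    ∫ x, f x * PDop (negP P) φ x = ∫ x, PDop P f x * φ x := by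
  rw [ibpP (negP P) hf hφ hc, negP_negP]

lemma smooth_comp_neg {f : EE d → ℂ} (hf : Smooth f) : Smooth (fun y => f (-y)) :=
  hf.comp contDiff_neg

lemma smooth_comp_add {f : EE d → ℂ} (hf : Smooth f) (a : EE d) : Smooth (fun y => f (y + a)) :=
  hf.comp (contDiff_id.add contDiff_const)

lemma PDop_refl (P : MvPolynomial (Fin d) ℂ) : ∀ {f : EE d → ℂ}, Smooth f →
    PDop P (fun y => f (-y)) = fun y => PDop (negP P) f (-y) := by
  induction P using MvPolynomial.induction_on with
  | C c =>
    intro f hf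
    rw [negP_C, PDop_C, PDop_C]
    rfl
  | add p q hp hq =>
    intro f hf
    rw [negP_add, PDop_polyadd (smooth_comp_neg hf), PDop_polyadd hf, hp hf, hq hf]
    rfl
  | mul_X p i hp =>
    intro f hf
    rw [PDop_mul (smooth_comp_neg hf), PDop_X (smooth_comp_neg hf), pderivE_comp_neg, negP_mul,
      negP_X, mul_neg, PDop_neg_poly hf, PDop_mul hf, PDop_X hf]
    have h1 : (fun y => - pderivE i f (-y)) = (-1 : ℂ) • (fun y => pderivE i f (-y)) := by
      funext y; simp
    rw [h1, PDop_smul (smooth_comp_neg (smooth_pderivE hf i)), hp (smooth_pderivE hf i)]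
    funext y
    simp

lemma smooth_refl {f : EE d → ℂ} (hf : Smooth f) (x : EE d) : Smooth (fun t => f (x - t)) :=
  hf.comp (contDiff_const.sub contDiff_id)

lemma hcs_refl {f : EE d → ℂ} (hf : HasCompactSupport f) (x : EE d) :
    HasCompactSupport (fun t => f (x - t)) :=
  hf.comp_homeomorph (Homeomorph.subLeft x)

lemma PDop_refl' (P : MvPolynomial (Fin d) ℂ) {f : EE d → ℂ} (hf : Smooth f) (x : EE d) :
    PDop (negP P) (fun t => f (x - t)) = fun t => PDop P f (x - t) := by
  have h := PDop_refl (negP P) (smooth_comp_add hf x)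
  rw [negP_negP, PDop_comp_add] at h
  have e : ∀ t : EE d, -t + x = x - t := fun t => by abel
  simpa only [e] using h

/-- convolution -/
def cv (E θ : EE d → ℂ) (x : EE d) : ℂ := ∫ t, E t * θ (x - t)

lemma cv_eq (E θ : EE d → ℂ) :
    cv E θ = MeasureTheory.convolution E θ (ContinuousLinearMap.mul ℝ ℂ) volume := by
  funext x
  simp [cv, MeasureTheory.convolution]

lemma smooth_cv {E θ : EE d → ℂ} (hE : LocallyIntegrable E) (hθ : Smooth θ)
    (hc : HasCompactSupport θ) : Smooth (cv E θ) := by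
  rw [cv_eq]
  exact hc.contDiff_convolution_right _ hE hθ

lemma pderivE_cv {E θ : EE d → ℂ} (hE : LocallyIntegrable E) (hθ : Smooth θ)
    (hc : HasCompactSupport θ) (i : Fin d) : pderivE i (cv E θ) = cv E (pderivE i θ) := by
  funext x
  have h := hc.hasFDerivAt_convolution_right (ContinuousLinearMap.mul ℝ ℂ) hE
    (hθ.of_le (by simp)) x
  rw [← cv_eq] at h
  simp only [pderivE]
  rw [h.fderiv]
  rw [convolution_precompR_apply]
  · rw [← cv_eq]
    rfl
  · exact hE
  · exact hc.fderiv ℝ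
  · exact hθ.continuous_fderiv (by simp)

lemma PDop_cv {E : EE d → ℂ} (hE : LocallyIntegrable E) (P : MvPolynomial (Fin d) ℂ) :
    ∀ {θ : EE d → ℂ}, Smooth θ → HasCompactSupport θ → PDop P (cv E θ) = cv E (PDop P θ) := by
  have hi : ∀ {θ : EE d → ℂ}, Smooth θ → HasCompactSupport θ → ∀ x,
      Integrable (fun t => E t * θ (x - t)) := fun hθ hc x => by
    have := (hc.convolutionExists_right (ContinuousLinearMap.mul ℝ ℂ) hE hθ.continuous) x
    simpa [ConvolutionExistsAt] using this
  induction P using MvPolynomial.induction_on with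
  | C c =>
    intro θ hθ hc
    rw [PDop_C, PDop_C]
    funext x
    simp only [cv, Pi.smul_apply, smul_eq_mul]
    rw [← integral_const_mul]
    refine integral_congr_ae (Eventually.of_forall fun x => ?_)
    simp
    ring
  | add p q hp hq =>
    intro θ hθ hc
    rw [PDop_polyadd (smooth_cv hE hθ hc), PDop_polyadd hθ, hp hθ hc, hq hθ hc]
    funext x
    simp only [cv, Pi.add_apply, mul_add]
    rw [integral_add (hi (smooth_PDop hθ _) (hcs_PDop hθ hc _) x)
      (hi (smooth_PDop hθ _) (hcs_PDop hθ hc _) x)]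
  | mul_X p i hp =>
    intro θ hθ hc
    rw [PDop_mul (smooth_cv hE hθ hc), PDop_X (smooth_cv hE hθ hc), PDop_mul hθ, PDop_X hθ,
      pderivE_cv hE hθ hc, hp (smooth_pderivE hθ i) (hcs_pderivE hc i)]

lemma cv_PDop_left {g ρ : EE d → ℂ} (hg : Smooth g) (hρ : Smooth ρ) (hc : HasCompactSupport ρ)
    (P : MvPolynomial (Fin d) ℂ) : PDop P (cv g ρ) = cv (PDop P g) ρ := by
  rw [PDop_cv hg.continuous.locallyIntegrable P hρ hc]
  funext x
  have := ibpP' P hg (smooth_refl hρ x) (hcs_refl hc x)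
  rw [PDop_refl' P hρ x] at this
  exact this

lemma cv_comm (E θ : EE d → ℂ) : cv E θ = cv θ E := by
  funext x
  unfold cv
  rw [← integral_sub_left_eq_self _ _ x]
  refine integral_congr_ae (Eventually.of_forall fun t => ?_)
  simp [mul_comm]

end conv
end PDEaux
end

noncomputable section
namespace PDEaux
open MeasureTheory Set Filter Topology
section fund
variable {d : ℕ}

lemma riesz_rep {V H : Type*} [AddCommGroup V] [Module ℂ V] [NormedAddCommGroup H]
    [InnerProductSpace ℂ H] [CompleteSpace H] (T : V →ₗ[ℂ] H) (ev : V →ₗ[ℂ] ℂ) (C : ℝ)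
    (h : ∀ v, ‖ev v‖ ≤ C * ‖T v‖) : ∃ e : H, ∀ v, inner ℂ e (T v) = ev v := by
  have hk : ev ∈ (LinearMap.ker T).dualAnnihilator := by
    rw [Submodule.mem_dualAnnihilator]
    intro v hv
    have := h v
    rw [LinearMap.mem_ker.1 hv] at this
    simpa using this
  rw [← LinearMap.range_dualMap_eq_dualAnnihilator_ker] at hk
  obtain ⟨g, hg⟩ := hk
  let p := LinearMap.range T
  let g0 : p →L[ℂ] ℂ := LinearMap.mkContinuous (g.domRestrict p) C (by
    rintro ⟨_, v, rfl⟩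
    have e : g (T v) = ev v := by rw [← hg]; rfl
    simpa [e] using h v)
  obtain ⟨G, hG, -⟩ := exists_extension_norm_eq p g0
  refine ⟨(InnerProductSpace.toDual ℂ H).symm G, fun v => ?_⟩
  rw [InnerProductSpace.toDual_symm_apply]
  have := hG ⟨T v, v, rfl⟩
  rw [this, ← hg]
  rfl

/-- product of the derivatives in a finite set of directions -/
def QS (S : Finset (Fin d)) : MvPolynomial (Fin d) ℂ := ∏ i ∈ S, MvPolynomial.X i

lemma QS_ne_zero (S : Finset (Fin d)) : QS S ≠ 0 :=
  Finset.prod_ne_zero_iff.2 fun i _ => MvPolynomial.X_ne_zero i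

lemma one_dim {φ : EE d → ℂ} (hφ : Smooth φ) (hc : HasCompactSupport φ) (i : Fin d)
    (y : Fin d → ℝ) : ‖φ (WithLp.toLp 2 y)‖ₑ ≤
      ∫⁻ s : ℝ, ‖pderivE i φ (WithLp.toLp 2 (Function.update y i s))‖ₑ := by
  set u : ℝ → ℂ := fun s => φ (WithLp.toLp 2 (Function.update y i s)) with hu
  have hL : ∀ s, WithLp.toLp 2 (Function.update y i s) =
      WithLp.toLp 2 (Function.update y i 0) + s • (EuclideanSpace.single i (1 : ℝ)) := by
    intro s
    ext j
    by_cases h : j = i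
    · subst h; simp
    · simp [h]
  have hder : ∀ s, HasDerivAt u (pderivE i φ (WithLp.toLp 2 (Function.update y i s))) s := by
    intro s
    have h1 : HasDerivAt (fun s : ℝ => WithLp.toLp 2 (Function.update y i 0) +
        s • (EuclideanSpace.single i (1 : ℝ) : EE d)) (EuclideanSpace.single i (1 : ℝ)) s := by
      simpa using ((hasDerivAt_id s).smul_const (EuclideanSpace.single i (1 : ℝ) : EE d)).const_add
        (WithLp.toLp 2 (Function.update y i 0))
    have h2 := (hφ.diff (WithLp.toLp 2 (Function.update y i s))).hasFDerivAt
    rw [hL s] at h2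
    have h3 := h2.comp_hasDerivAt s h1
    have h4 : (φ ∘ fun s : ℝ => WithLp.toLp 2 (Function.update y i 0) +
        s • (EuclideanSpace.single i (1 : ℝ) : EE d)) = u := by
      funext s
      simp only [hu, Function.comp, hL s]
    rw [h4] at h3
    simp only [pderivE]
    rw [hL s]
    exact h3
  have huc : ContDiff ℝ 1 u := by
    have : ContDiff ℝ (⊤ : ℕ∞) u := by
      rw [hu, show (fun s => φ (WithLp.toLp 2 (Function.update y i s))) = fun s : ℝ =>
        φ (WithLp.toLp 2 (Function.update y i 0) + s • (EuclideanSpace.single i (1 : ℝ))) from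
        funext fun s => congrArg φ (hL s)]
      exact hφ.comp (contDiff_const.add (contDiff_id.smul contDiff_const))
    exact this.of_le (by simp)
  have hcu : HasCompactSupport u := by
    obtain ⟨R, -, hR⟩ := vanish_of_hcs hc
    refine HasCompactSupport.intro (isCompact_closedBall (0 : ℝ) R) fun s hs => hR _ ?_
    have h1 : R < |s| := by simpa using hs
    have h2 := PiLp.norm_apply_le (WithLp.toLp 2 (Function.update y i s) : EE d) i
    simp at h2
    exact h1.trans_le h2
  have key := hcu.enorm_le_lintegral_Ici_deriv huc (y i)
  have e1 : u (y i) = φ (WithLp.toLp 2 y) := by simp [hu]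
  rw [e1] at key
  refine key.trans ((setLIntegral_le_lintegral _ _).trans_eq ?_)
  refine lintegral_congr fun s => ?_
  rw [(hder s).deriv]

lemma marginal_bound {φ : EE d → ℂ} (hφ : Smooth φ) (hc : HasCompactSupport φ)
    (S : Finset (Fin d)) : ∀ y : Fin d → ℝ, ‖φ (WithLp.toLp 2 y)‖ₑ ≤
      lmarginal (fun _ => volume) S (fun z => ‖PDop (QS S) φ (WithLp.toLp 2 z)‖ₑ) y := by
  induction S using Finset.induction_on with
  | empty =>
    intro y
    have : (QS (∅ : Finset (Fin d))) = MvPolynomial.C 1 := by simp [QS]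
    rw [this, PDop_C]
    simp
  | insert i S hi ih =>
    intro y
    have hq : PDop (QS (insert i S)) φ = pderivE i (PDop (QS S) φ) := by
      rw [QS, Finset.prod_insert hi, PDop_mul hφ, PDop_X (smooth_PDop hφ _)]
      rfl
    have hm : Measurable (fun z : Fin d → ℝ =>
        ‖PDop (QS (insert i S)) φ (WithLp.toLp 2 z)‖ₑ) := by
      have : Continuous (fun z : Fin d → ℝ => PDop (QS (insert i S)) φ (WithLp.toLp 2 z)) :=
        (smooth_PDop hφ _).continuous.comp (PiLp.continuous_toLp 2 _)
      exact this.enorm.measurable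
    rw [lmarginal_insert' _ hm hi]
    refine (ih y).trans (lmarginal_mono ?_ y)
    intro z
    rw [hq]
    exact one_dim (smooth_PDop hφ _) (hcs_PDop hφ hc _) i z

lemma sup_le_L1 {φ : EE d → ℂ} (hφ : Smooth φ) (hc : HasCompactSupport φ) (x : EE d) :
    ‖φ x‖ₑ ≤ ∫⁻ z, ‖PDop (QS Finset.univ) φ z‖ₑ := by
  have h := marginal_bound hφ hc Finset.univ (WithLp.ofLp x)
  rw [lmarginal_univ] at h
  refine h.trans_eq ?_
  have hp := PiLp.volume_preserving_toLp (Fin d)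
  have := hp.lintegral_comp
    (f := fun z => ‖PDop (QS Finset.univ) φ z‖ₑ) ((smooth_PDop hφ _).continuous.enorm.measurable)
  rw [← this]
  rfl

lemma L1_le_L2 (R : ℝ) : ∃ C : ℝ, 0 ≤ C ∧ ∀ φ : (tsD d R).V,
    (∫⁻ z, ‖(φ : EE d → ℂ) z‖ₑ) ≤ ENNReal.ofReal (C * ‖iotaW R 0 φ‖) := by
  set B : Set (EE d) := Metric.closedBall 0 R
  have hB : volume B ≠ ⊤ := (isCompact_closedBall (0 : EE d) R).measure_lt_top.ne
  refine ⟨((volume B) ^ (1 / 2 : ℝ)).toReal, ENNReal.toReal_nonneg, fun φ => ?_⟩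
  have hm : MemLp (φ : EE d → ℂ) 2 (volume : Measure (EE d)) := memLp_of_ts φ.2.1.continuous φ.2.2
  have e0 : ‖iotaW R 0 φ‖ = (eLpNorm (φ : EE d → ℂ) 2 volume).toReal := by
    have : ‖iotaW R 0 φ‖ = (eLpNorm (fun x => wt 0 x * (φ : EE d → ℂ) x) 2 volume).toReal :=
      Lp.norm_toLp _ (memLp_wt 0 φ)
    rw [this]
    congr 2
    funext x
    simp [wt]
  have e1 : (∫⁻ z, ‖(φ : EE d → ℂ) z‖ₑ) = ∫⁻ z in B, ‖(φ : EE d → ℂ) z‖ₑ := by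
    rw [setLIntegral_eq_of_support_subset]
    intro z hz
    by_contra h
    apply hz
    have : R < ‖z‖ := by simpa [B] using h
    simp [φ.2.2 z this]
  rw [e1, ← eLpNorm_one_eq_lintegral_enorm]
  have h2 := eLpNorm_le_eLpNorm_mul_rpow_measure_univ (μ := volume.restrict B) (p := 1) (q := 2)
    (by norm_num) hm.1.restrict
  refine h2.trans ?_
  rw [ENNReal.ofReal_mul ENNReal.toReal_nonneg, e0, ENNReal.ofReal_toReal hm.2.ne,
    ENNReal.ofReal_toReal (ENNReal.rpow_ne_top_of_nonneg (by norm_num) hB), mul_comm]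
  rw [Measure.restrict_apply MeasurableSet.univ, univ_inter, mul_comm,
    show (1 / (1 : ENNReal).toReal - 1 / (2 : ENNReal).toReal : ℝ) = 1 / 2 by norm_num]
  have h3 : eLpNorm (φ : EE d → ℂ) 2 (volume.restrict B) ≤ eLpNorm (φ : EE d → ℂ) 2 volume :=
    eLpNorm_mono_measure _ Measure.restrict_le_self
  rw [mul_comm]
  gcongr

lemma sobolev {R : ℝ} (hR : 0 ≤ R) (P : MvPolynomial (Fin d) ℂ) (hP : P ≠ 0) :
    ∃ C : ℝ, 0 ≤ C ∧ ∀ (φ : (tsD d R).V) (x : EE d),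
      ‖(φ : EE d → ℂ) x‖ ≤ C * ‖iotaW R 0 ((tsD d R).Phi (P * QS Finset.univ) φ)‖ := by
  obtain ⟨C1, hC1, h1⟩ := L1_le_L2 (d := d) R
  obtain ⟨C2, hC2, h2⟩ := hormanderW hR P hP
  refine ⟨C1 * C2, by positivity, fun φ x => ?_⟩
  have h3 := (sup_le_L1 φ.2.1 (hcs_of_vanish φ.2.2) x)
  rw [← DMod.coe_Phi] at h3
  have h4 := h3.trans (h1 _)
  rw [← ofReal_norm, ENNReal.ofReal_le_ofReal_iff] at h4
  · have h5 := h2 0 ((tsD d R).Phi (QS Finset.univ) φ)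
    rw [map_mul, Module.End.mul_apply, mul_assoc]
    exact h4.trans (mul_le_mul_of_nonneg_left h5 hC1)
  · positivity

theorem fundsol {R : ℝ} (hR : 0 ≤ R) (P : MvPolynomial (Fin d) ℂ) (hP : P ≠ 0) :
    ∃ (E : EE d → ℂ) (Q : MvPolynomial (Fin d) ℂ), Integrable E ∧
      ∀ ψ : EE d → ℂ, Smooth ψ → (∀ x, R < ‖x‖ → ψ x = 0) →
        ∫ t, E t * PDop (negP (P * Q)) ψ t = ψ 0 := by
  set S := negP P * QS (Finset.univ : Finset (Fin d))
  obtain ⟨C, hC, h⟩ := sobolev hR (negP P) (negP_ne_zero hP)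
  let ev : (tsD d R).V →ₗ[ℂ] ℂ := (LinearMap.proj (0 : EE d)).domRestrict (tsD d R).V
  obtain ⟨e, he⟩ := riesz_rep ((iotaW R 0).comp ((tsD d R).Phi S)) ev C (fun v => h v 0)
  set B : Set (EE d) := Metric.closedBall 0 R
  have heB : MemLp (e : EE d → ℂ) 2 (volume : Measure (EE d)) := Lp.memLp e
  refine ⟨B.indicator (fun x => (starRingEnd ℂ) (e x)), negP (QS Finset.univ), ?_, ?_⟩
  · rw [integrable_indicator_iff Metric.isClosed_closedBall.measurableSet]
    have h1 : MemLp (fun x => (starRingEnd ℂ) (e x)) 2 (volume.restrict B) :=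
      (MemLp.star heB).restrict B
    have : IsFiniteMeasure (volume.restrict B) :=
      ⟨by simpa using (isCompact_closedBall (0 : EE d) R).measure_lt_top⟩
    exact h1.integrable (by norm_num)
  · intro ψ hψ hv
    have h1 := he ⟨ψ, hψ, hv⟩
    have h2 : ev ⟨ψ, hψ, hv⟩ = ψ 0 := rfl
    rw [← h2, ← h1, negP_mul, negP_negP, L2.inner_def]
    refine integral_congr_ae ?_
    filter_upwards [(memLp_wt 0 ((tsD d R).Phi S ⟨ψ, hψ, hv⟩)).coeFn_toLp] with x hx
    have hx' : (iotaW R 0 ((tsD d R).Phi S ⟨ψ, hψ, hv⟩) : EE d → ℂ) x = _ := hx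
    simp only [LinearMap.comp_apply]
    rw [hx', DMod.coe_Phi]
    by_cases hxB : x ∈ B
    · simp [hxB, wt, S, mul_comm]
    · have : R < ‖x‖ := by simpa [B] using hxB
      simp [hxB, wt, PDop_vanish hψ hv S x this]

end fund
end PDEaux
end

noncomputable section
namespace PDEaux
open MeasureTheory Set Filter Topology
open scoped ContDiff Manifold
section cut
variable {d : ℕ}

lemma cutoff {K U : Set (EE d)} (hK : IsCompact K) (hU : IsOpen U) (hKU : K ⊆ U) :
    ∃ χ : EE d → ℂ, Smooth χ ∧ HasCompactSupport χ ∧ tsupport χ ⊆ U ∧ ∀ᶠ x in 𝓝ˢ K, χ x = 1 := by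
  obtain ⟨L, hL, hKL, hLU⟩ := exists_compact_between hK hU hKU
  obtain ⟨f, h1, h0, -⟩ := exists_contMDiffMap_one_nhds_of_subset_interior (n := (⊤ : ℕ∞))
    (𝓘(ℝ, EE d)) hK.isClosed hKL
  have hs : tsupport (fun x => ((f x : ℝ) : ℂ)) ⊆ L := by
    refine closure_minimal (fun x hx => ?_) hL.isClosed
    by_contra hxL
    exact hx (by simp [h0 x hxL])
  refine ⟨fun x => (f x : ℝ), Complex.ofRealCLM.contDiff.comp f.contMDiff.contDiff,
    hL.of_isClosed_subset (isClosed_tsupport _) hs, hs.trans hLU, ?_⟩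
  filter_upwards [h1] with x hx
  simp [hx]

lemma contDiff_of_ts {f : EE d → ℂ} (h : ∀ x ∈ tsupport f, ContDiffAt ℝ (⊤ : ℕ∞) f x) :
    Smooth f := by
  refine contDiff_iff_contDiffAt.2 fun x => ?_
  by_cases hx : x ∈ tsupport f
  · exact h x hx
  · refine (contDiffAt_const (c := (0 : ℂ))).congr_of_eventuallyEq ?_
    exact notMem_tsupport_iff_eventuallyEq.1 hx

lemma cutoff_fun {Y K : Set (EE d)} {f : EE d → ℂ} (hY : IsOpen Y) (hK : IsCompact K)
    (hKY : K ⊆ Y) (hf : ContDiffOn ℝ (⊤ : ℕ∞) f Y) :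
    ∃ F : EE d → ℂ, Smooth F ∧ HasCompactSupport F ∧ tsupport F ⊆ Y ∧
      ∀ᶠ x in 𝓝ˢ K, F x = f x := by
  obtain ⟨χ, h1, h2, h3, h4⟩ := cutoff hK hY hKY
  have hs : tsupport (fun x => χ x * f x) ⊆ tsupport χ := tsupport_mul_subset_left
  refine ⟨fun x => χ x * f x, ?_, h2.mul_right, hs.trans h3, ?_⟩
  · refine contDiff_of_ts fun x hx => ?_
    exact h1.contDiffAt.mul ((hf x (h3 (hs hx))).contDiffAt (hY.mem_nhds (h3 (hs hx))))
  · filter_upwards [h4] with x hx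
    simp [hx]

lemma sep {φ : EE d → ℂ} (hφ : Smooth φ) {U : Set (EE d)} (hU : IsOpen U) {x0 : EE d}
    (hx0 : x0 ∈ U) (h0 : φ x0 ≠ 0) : ∃ θ : EE d → ℂ, Smooth θ ∧ HasCompactSupport θ ∧
      tsupport θ ⊆ U ∧ ∫ x, φ x * θ x ≠ 0 := by
  obtain ⟨χ, h1, h2, h3, h4, h5⟩ := exists_contDiff_tsupport_subset (n := ⊤) (hU.mem_nhds hx0)
  have h4' : ∀ x, 0 ≤ χ x := fun x => (h4 ⟨x, rfl⟩).1
  refine ⟨fun x => (χ x : ℂ) * (starRingEnd ℂ) (φ x), ?_, ?_, ?_, ?_⟩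
  · exact (Complex.ofRealCLM.contDiff.comp h3).mul (smooth_conj hφ)
  · exact HasCompactSupport.mul_right (h2.comp_left (g := fun r : ℝ => (r : ℂ)) (by simp))
  · refine tsupport_mul_subset_left.trans (Subset.trans ?_ h1)
    exact closure_mono fun x hx => by simpa using hx
  · have e : ∀ x, φ x * ((χ x : ℂ) * (starRingEnd ℂ) (φ x)) = ((χ x * ‖φ x‖ ^ 2 : ℝ) : ℂ) := by
      intro x
      rw [mul_left_comm, Complex.mul_conj, Complex.normSq_eq_norm_sq]
      push_cast
      ring
    simp only [e]
    rw [show (∫ x, ((χ x * ‖φ x‖ ^ 2 : ℝ) : ℂ)) = ((∫ x, χ x * ‖φ x‖ ^ 2 : ℝ) : ℂ) from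
      integral_ofReal]
    have : 0 < ∫ x, χ x * ‖φ x‖ ^ 2 := by
      apply Continuous.integral_pos_of_hasCompactSupport_nonneg_nonzero (x := x0)
      · exact h3.continuous.mul (hφ.continuous.norm.pow 2)
      · exact h2.mul_right
      · intro x
        have := h4' x
        positivity
      · simp [h5, h0]
    exact_mod_cast this.ne'

lemma fub {u v : EE d → ℂ} (hu : Integrable u) (hv : Integrable v) {k : EE d → EE d → ℂ}
    (hk : Continuous (Function.uncurry k)) {C : ℝ} (hC : ∀ x t, ‖k x t‖ ≤ C) :
    ∫ x, u x * ∫ t, v t * k x t = ∫ t, v t * ∫ x, u x * k x t := by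
  have hi : Integrable (Function.uncurry fun x t => u x * (v t * k x t))
      ((volume : Measure (EE d)).prod (volume : Measure (EE d))) := by
    have h1 := hu.mul_prod hv
    have h2 := h1.mul_bdd (g := fun z : EE d × EE d => k z.1 z.2) (c := C)
      hk.aestronglyMeasurable
      (Eventually.of_forall fun z => hC z.1 z.2)
    refine h2.congr (Eventually.of_forall fun z => ?_)
    simp [Function.uncurry, mul_assoc]
  simp only [← integral_const_mul]
  rw [integral_integral_swap hi]
  refine integral_congr_ae (Eventually.of_forall fun t => integral_congr_ae
    (Eventually.of_forall fun x => ?_))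
  simp only
  ring

lemma exists_bd {W : EE d → ℂ} (hW : Continuous W) (hc : HasCompactSupport W) :
    ∃ C, ∀ x, ‖W x‖ ≤ C := hW.bounded_above_of_compact_support hc |>.imp fun _ h => h

lemma cv_dual {E W θ : EE d → ℂ} (hE : Integrable E) (hW : Continuous W)
    (hWc : HasCompactSupport W) (hθ : Continuous θ) (hθc : HasCompactSupport θ) :
    ∫ x, cv (fun t => E (-t)) W x * θ x = ∫ x, W x * cv E θ x := by
  obtain ⟨C, hC⟩ := exists_bd hW hWc
  have h1 : ∀ x, cv (fun t => E (-t)) W x = ∫ t, E t * W (x + t) := by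
    intro x
    rw [cv, ← integral_neg_eq_self]
    simp
  have h2 : ∀ x, cv E θ x = ∫ t, E t * θ (x - t) := fun x => rfl
  have hθi : Integrable θ := hθ.integrable_of_hasCompactSupport hθc
  have hWi : Integrable W := hW.integrable_of_hasCompactSupport hWc
  obtain ⟨C', hC'⟩ := exists_bd hθ hθc
  have e1 := fub (k := fun x t => W (x + t)) hθi hE (by fun_prop) (fun x t => hC _)
  have e2 := fub (k := fun x t => θ (x - t)) hWi hE (by fun_prop) (fun x t => hC' _)
  simp only [h1, h2]
  rw [e2]
  simp only [mul_comm _ (θ _)]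
  rw [e1]
  congr 1
  funext t
  congr 1
  rw [← integral_add_right_eq_self (μ := volume) (fun x => θ (x - t) * W x) t]
  refine integral_congr_ae (Eventually.of_forall fun x => ?_)
  simp [mul_comm]

/-- `E` is a fundamental solution (with loss `Q`) on a ball of radius `R` -/
def IsFund (P Q : MvPolynomial (Fin d) ℂ) (R : ℝ) (E : EE d → ℂ) : Prop :=
  Integrable E ∧ ∀ ψ : EE d → ℂ, Smooth ψ → (∀ x, R < ‖x‖ → ψ x = 0) →
        ∫ t, E t * PDop (negP (P * Q)) ψ t = ψ 0

lemma IsFund.right {P Q : MvPolynomial (Fin d) ℂ} {R : ℝ} {E : EE d → ℂ} (h : IsFund P Q R E)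
    {θ : EE d → ℂ} (hθ : Smooth θ) (hv : ∀ x, R / 2 < ‖x‖ → θ x = 0) {x : EE d}
    (hx : ‖x‖ ≤ R / 2) : PDop P (cv E (PDop Q θ)) x = θ x := by
  have hc := hcs_of_vanish hv
  rw [PDop_cv h.1.locallyIntegrable P (smooth_PDop hθ _) (hcs_PDop hθ hc _), ← PDop_mul hθ]
  have := h.2 (fun t => θ (x - t)) (smooth_refl hθ x) (fun t ht => hv _ (by
    have := norm_sub_norm_le t x
    rw [norm_sub_rev] at this
    linarith))
  rw [PDop_refl' _ hθ] at this
  simpa [cv] using this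

lemma IsFund.left {P Q : MvPolynomial (Fin d) ℂ} {R : ℝ} {E : EE d → ℂ} (h : IsFund P Q R E)
    {w : EE d → ℂ} (hw : Smooth w) (hv : ∀ x, R / 2 < ‖x‖ → w x = 0) {x : EE d}
    (hx : ‖x‖ ≤ R / 2) :
    PDop (negP P) (cv (fun t => E (-t)) (PDop (negP Q) w)) x = w x := by
  have hc := hcs_of_vanish hv
  have hE' : Integrable (fun t => E (-t)) := h.1.comp_neg
  rw [PDop_cv hE'.locallyIntegrable _ (smooth_PDop hw _) (hcs_PDop hw hc _), ← PDop_mul hw,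
    ← negP_mul]
  have := h.2 (fun t => w (t + x)) (smooth_comp_add hw x) (fun t ht => hv _ (by
    have := norm_sub_norm_le t (-x)
    rw [sub_neg_eq_add, norm_neg] at this
    linarith))
  rw [PDop_comp_add] at this
  rw [cv, ← integral_neg_eq_self]
  simpa [add_comm] using this

theorem exists_fund (P : MvPolynomial (Fin d) ℂ) (hP : P ≠ 0) {R : ℝ} (hR : 0 ≤ R) :
    ∃ E Q, IsFund P Q R E := by
  obtain ⟨E, Q, h1, h2⟩ := fundsol hR P hP
  exact ⟨E, Q, h1, h2⟩

theorem local_solv (P : MvPolynomial (Fin d) ℂ) (hP : P ≠ 0) {h : EE d → ℂ} (hh : Smooth h)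
    (hc : HasCompactSupport h) (R : ℝ) :
    ∃ f : EE d → ℂ, Smooth f ∧ ∀ x, ‖x‖ ≤ R → PDop P f x = h x := by
  obtain ⟨R1, hR1, hv⟩ := vanish_of_hcs hc
  set R2 := max R R1
  obtain ⟨E, Q, hE⟩ := exists_fund P hP (R := 2 * R2) (by positivity)
  refine ⟨cv E (PDop Q h), smooth_cv hE.1.locallyIntegrable (smooth_PDop hh _) (hcs_PDop hh hc _),
    fun x hx => hE.right hh (fun y hy => hv y ?_) ?_⟩
  · have := le_max_right R R1
    change R1 ≤ R2 at this
    linarith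
  · have := le_max_left R R1
    change R ≤ R2 at this
    linarith

theorem dual_solv (P : MvPolynomial (Fin d) ℂ) (hP : P ≠ 0) {w : EE d → ℂ} (hw : Smooth w)
    {U : Set (EE d)} (hU : IsCompact U) (hwU : ∀ x ∉ U, w x = 0)
    (H : ∀ g : EE d → ℂ, Smooth g → (∀ x ∈ U, PDop P g x = 0) → ∫ x, g x * w x = 0) :
    ∃ φ : EE d → ℂ, Smooth φ ∧ HasCompactSupport φ ∧ (∀ x ∉ U, φ x = 0) ∧
      PDop (negP P) φ = w := by
  obtain ⟨R, hR0, hR⟩ := hU.isBounded.subset_ball_lt 0 (0 : EE d)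
  have hwc : HasCompactSupport w := HasCompactSupport.intro hU hwU
  obtain ⟨E, Q, hE⟩ := exists_fund P hP (R := 2 * R) (by positivity)
  have hR2 : 2 * R / 2 = R := by ring
  have hv : ∀ x, 2 * R / 2 < ‖x‖ → w x = 0 := fun x hx => hwU x fun hxU => by
    have := hR hxU
    rw [mem_ball_zero_iff] at this
    linarith
  set φ0 := cv (fun t => E (-t)) (PDop (negP Q) w) with hφ0
  have hE' : Integrable (fun t => E (-t)) := hE.1.comp_neg
  have hs0 : Smooth φ0 := smooth_cv hE'.locallyIntegrable (smooth_PDop hw _) (hcs_PDop hw hwc _)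
  have hz : ∀ x ∈ Metric.ball (0 : EE d) R, x ∉ U → φ0 x = 0 := by
    intro x hx hxU
    by_contra hne
    obtain ⟨θ, t1, t2, t3, t4⟩ := sep hs0 (Metric.isOpen_ball.sdiff hU.isClosed) ⟨hx, hxU⟩ hne
    apply t4
    rw [hφ0, cv_dual hE.1 (smooth_PDop hw _).continuous (hcs_PDop hw hwc _) t1.continuous t2]
    have hg := smooth_cv hE.1.locallyIntegrable t1 t2
    have e1 := ibpP' Q hg hw hwc
    rw [PDop_cv hE.1.locallyIntegrable Q t1 t2] at e1
    simp only [mul_comm (PDop (negP Q) w _)]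
    rw [e1]
    apply H _ (smooth_cv hE.1.locallyIntegrable (smooth_PDop t1 _) (hcs_PDop t1 t2 _))
    have hvt : ∀ y, y ∉ Metric.ball (0 : EE d) R \ U → θ y = 0 := fun y hy => by
      by_contra h
      exact hy (t3 (subset_tsupport _ h))
    intro y hy
    rw [hE.right t1 (fun z hz => hvt z fun h => ?_) ?_]
    · exact hvt y fun h => h.2 hy
    · have := hR hy
      rw [mem_ball_zero_iff] at this
      linarith
    · have := h.1
      rw [mem_ball_zero_iff] at this
      linarith
  obtain ⟨χ, c1, c2, c3, c4⟩ := cutoff hU Metric.isOpen_ball hR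
  have hoff : ∀ x ∉ U, χ x * φ0 x = 0 := by
    intro x hx
    by_cases hb : x ∈ Metric.ball (0 : EE d) R
    · rw [hz x hb hx, mul_zero]
    · rw [image_eq_zero_of_notMem_tsupport fun h => hb (c3 h), zero_mul]
  refine ⟨fun x => χ x * φ0 x, c1.mul hs0, c2.mul_right, hoff, ?_⟩
  funext x
  by_cases hx : x ∈ U
  · have h1 : (fun x => χ x * φ0 x) =ᶠ[𝓝 x] φ0 := by
      filter_upwards [(eventually_nhdsSet_iff_forall.1 c4 x hx)] with y hy
      simp [hy]
    rw [(PDop_congr h1 _).self_of_nhds]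
    refine hE.left hw hv ?_
    have := hR hx
    rw [mem_ball_zero_iff] at this
    linarith
  · have h1 : (fun x => χ x * φ0 x) =ᶠ[𝓝 x] 0 := by
      filter_upwards [hU.isClosed.isOpen_compl.mem_nhds hx] with y hy
      exact hoff y hy
    rw [(PDop_congr h1 _).self_of_nhds, PDop_zero, hwU x hx]
    rfl

theorem ball_hull (Q : MvPolynomial (Fin d) ℂ) (hQ : Q ≠ 0) {φ : EE d → ℂ} (hφ : Smooth φ)
    (hc : HasCompactSupport φ) {r : ℝ} (hr : 0 ≤ r) (h : ∀ x, r < ‖x‖ → PDop Q φ x = 0) :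
    ∀ x, r < ‖x‖ → φ x = 0 := by
  intro x0 hx0
  by_contra hne
  obtain ⟨R, hR0, hv⟩ := vanish_of_hcs hc
  obtain ⟨C, hC, hH⟩ := hormanderW hR0.le Q hQ
  let Φ : (tsD d R).V := ⟨φ, hφ, hv⟩
  have hx0' : 0 < ‖x0‖ := hr.trans_lt hx0
  set e : EE d := (‖x0‖⁻¹) • x0
  have hen : ‖e‖ = 1 := by simp [e, norm_smul, hx0'.ne']
  have hee : inner ℝ e x0 = ‖x0‖ := by
    simp only [e, inner_smul_left, real_inner_self_eq_norm_sq, conj_trivial]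
    field_simp
  obtain ⟨r1, hr1, hr1'⟩ := exists_between hx0
  have hN : {x : EE d | r1 < inner ℝ e x} ∈ 𝓝 x0 := by
    apply (isOpen_lt continuous_const (by fun_prop)).mem_nhds
    simpa [hee] using hr1'
  obtain ⟨χ, c1, c2, c3, c4, c5⟩ := exists_contDiff_tsupport_subset (n := ⊤) hN
  have hmem : MemLp (fun x => (χ x : ℂ) * φ x) 2 (volume : Measure (EE d)) :=
    memLp_of_ts (R := R) ((Complex.continuous_ofReal.comp c3.continuous).mul hφ.continuous)
      (fun x hx => by rw [hv x hx, mul_zero])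
  set n := hmem.toLp
  set q := (tsD d R).Phi Q Φ
  have hqe : (q : EE d → ℂ) = PDop Q φ := DMod.coe_Phi _ _ _
  have b1 : ∀ τ : ℝ, 0 ≤ τ → ‖n‖ ≤ Real.exp (-(τ * r1)) * ‖iotaW R (τ • e) Φ‖ := by
    intro τ hτ
    refine Lp.norm_le_mul_norm_of_ae_le_mul ?_
    filter_upwards [hmem.coeFn_toLp, (memLp_wt (τ • e) Φ).coeFn_toLp] with x h1 h2
    have h2' : (iotaW R (τ • e) Φ : EE d → ℂ) x = _ := h2
    rw [h1, h2', norm_mul, norm_mul, ← mul_assoc]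
    refine mul_le_mul_of_nonneg_right ?_ (norm_nonneg _)
    rw [wt, Complex.norm_real, Complex.norm_real, Real.norm_of_nonneg (Real.exp_pos _).le,
      ← Real.exp_add, inner_smul_left]
    by_cases hx : χ x = 0
    · simp [hx]; positivity
    · have h3 : r1 < inner ℝ e x := c1 (subset_tsupport _ hx)
      have h4 := (c4 ⟨x, rfl⟩)
      rw [Real.norm_of_nonneg h4.1]
      refine h4.2.trans (Real.one_le_exp ?_)
      have := mul_le_mul_of_nonneg_left h3.le hτ
      simp
      linarith
  have b2 : ∀ τ : ℝ, 0 ≤ τ → ‖iotaW R (τ • e) q‖ ≤ Real.exp (τ * r) * ‖iotaW R 0 q‖ := by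
    intro τ hτ
    refine Lp.norm_le_mul_norm_of_ae_le_mul ?_
    filter_upwards [(memLp_wt 0 q).coeFn_toLp, (memLp_wt (τ • e) q).coeFn_toLp] with x h1 h2
    have h1' : (iotaW R 0 q : EE d → ℂ) x = _ := h1
    have h2' : (iotaW R (τ • e) q : EE d → ℂ) x = _ := h2
    rw [h1', h2', norm_mul, norm_mul, ← mul_assoc]
    by_cases hx : r < ‖x‖
    · simp [hqe, h x hx]
    · refine mul_le_mul_of_nonneg_right ?_ (norm_nonneg _)
      simp only [wt, Complex.norm_real, Real.norm_of_nonneg (Real.exp_pos _).le, inner_zero_left,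
        Real.exp_zero, inner_smul_left, Complex.ofReal_one, norm_one, mul_one]
      apply Real.exp_le_exp.2
      have h5 : inner ℝ e x ≤ r := (real_inner_le_norm e x).trans (by rw [hen]; linarith)
      simpa using mul_le_mul_of_nonneg_left h5 hτ
  have b3 : ∀ τ : ℝ, 0 ≤ τ → ‖n‖ ≤ Real.exp (-(τ * (r1 - r))) * (C * ‖iotaW R 0 q‖) := by
    intro τ hτ
    calc ‖n‖ ≤ _ := b1 τ hτ
      _ ≤ Real.exp (-(τ * r1)) * (C * (Real.exp (τ * r) * ‖iotaW R 0 q‖)) := by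
        gcongr
        exact (hH _ _).trans (by gcongr; exact b2 τ hτ)
      _ = _ := by
        rw [show -(τ * (r1 - r)) = -(τ * r1) + τ * r by ring, Real.exp_add]
        ring
  have hlim : Tendsto (fun τ : ℝ => Real.exp (-(τ * (r1 - r))) * (C * ‖iotaW R 0 q‖)) atTop
      (𝓝 (0 * (C * ‖iotaW R 0 q‖))) := by
    refine Tendsto.mul_const _ ?_
    refine Real.tendsto_exp_neg_atTop_nhds_zero.comp ?_
    exact tendsto_id.atTop_mul_const (by linarith)
  rw [zero_mul] at hlim
  have hn0 : ‖n‖ ≤ 0 := ge_of_tendsto hlim (by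
    filter_upwards [eventually_ge_atTop 0] with τ hτ using b3 τ hτ)
  have hn : n = 0 := norm_le_zero_iff.1 hn0
  have hae : (fun x => (χ x : ℂ) * φ x) =ᵐ[volume] fun _ => 0 := by
    have h1 := hmem.coeFn_toLp
    change (n : EE d → ℂ) =ᵐ[volume] _ at h1
    rw [hn] at h1
    exact h1.symm.trans (Lp.coeFn_zero _ _ _)
  have heq := (((Complex.continuous_ofReal.comp c3.continuous).mul hφ.continuous).ae_eq_iff_eq
    volume continuous_const).1 hae
  have := congrFun heq x0
  simp [c5, hne] at this

end cut
end PDEaux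
end

noncomputable section
namespace PDEaux
open MeasureTheory Set Filter Topology
section hull
variable {d : ℕ}

/-- closed exhaustion sets -/
def LS (X : Set (EE d)) (r s : ℝ) : Set (EE d) := {x | ‖x‖ ≤ r ∧ ∀ y ∉ X, s ≤ dist x y}

lemma isClosed_DS (X : Set (EE d)) (s : ℝ) : IsClosed {x : EE d | ∀ y ∉ X, s ≤ dist x y} := by
  simp only [setOf_forall]
  exact isClosed_iInter fun y => isClosed_iInter fun _ =>
    isClosed_le continuous_const (continuous_id.dist continuous_const)

lemma isCompact_LS (X : Set (EE d)) (r s : ℝ) : IsCompact (LS X r s) := by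
  have : LS X r s = Metric.closedBall 0 r ∩ {x : EE d | ∀ y ∉ X, s ≤ dist x y} := by
    ext x; simp [LS]
  rw [this]
  exact (isCompact_closedBall _ _).inter_right (isClosed_DS X s)

lemma LS_sub {X : Set (EE d)} {r s : ℝ} (hs : 0 < s) : LS X r s ⊆ X := by
  intro x hx
  by_contra h
  have := hx.2 x h
  rw [dist_self] at this
  linarith

lemma LS_mono {X : Set (EE d)} {r s r' s' : ℝ} (hr : r ≤ r') (hs : s' ≤ s) :
    LS X r s ⊆ LS X r' s' := fun _ hx => ⟨hx.1.trans hr, fun y hy => hs.trans (hx.2 y hy)⟩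

lemma LS_thick {X : Set (EE d)} {r s δ : ℝ} {x z : EE d} (hx : x ∈ LS X r s)
    (hz : dist z x ≤ δ) : z ∈ LS X (r + δ) (s - δ) := by
  refine ⟨?_, fun y hy => ?_⟩
  · have := norm_le_norm_add_norm_sub x z
    rw [← dist_eq_norm, dist_comm] at this
    linarith [hx.1]
  · have := hx.2 y hy
    have := dist_triangle x z y
    rw [dist_comm x z] at this
    linarith

lemma LS_nhds {X : Set (EE d)} {r s r' s' : ℝ} (hr : r < r') (hs : s' < s) {x : EE d}
    (hx : x ∈ LS X r s) : LS X r' s' ∈ 𝓝 x := by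
  set δ := min (r' - r) (s - s')
  have hδ : 0 < δ := lt_min (by linarith) (by linarith)
  refine mem_of_superset (Metric.closedBall_mem_nhds x hδ) fun z hz => ?_
  have h1 : δ ≤ r' - r := min_le_left _ _
  have h2 : δ ≤ s - s' := min_le_right _ _
  exact LS_mono (by linarith) (by linarith) (LS_thick hx hz)

lemma exists_thick {K X : Set (EE d)} (hK : IsCompact K) (hX : IsOpen X) (h : K ⊆ X) :
    ∃ δ : ℝ, 0 < δ ∧ ∀ x ∈ K, ∀ z, dist z x ≤ δ → z ∈ X := by
  obtain ⟨δ, hδ, h1⟩ := hK.exists_cthickening_subset_open hX h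
  exact ⟨δ, hδ, fun x hx z hz => h1 (Metric.mem_cthickening_of_dist_le z x δ K hx hz)⟩

lemma exists_LS {K X : Set (EE d)} (hK : IsCompact K) (hX : IsOpen X) (h : K ⊆ X) :
    ∃ r s : ℝ, 0 < r ∧ 0 < s ∧ K ⊆ LS X r s := by
  obtain ⟨δ, hδ, h1⟩ := exists_thick hK hX h
  obtain ⟨r, hr, h2⟩ := hK.isBounded.subset_ball_lt 0 (0 : EE d)
  refine ⟨r, δ, hr, hδ, fun x hx => ⟨?_, fun y hy => ?_⟩⟩
  · have := h2 hx
    rw [mem_ball_zero_iff] at this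
    exact this.le
  · by_contra hlt
    exact hy (h1 x hx y (by rw [dist_comm]; linarith))

lemma PDop_off {φ : EE d → ℂ} {x : EE d} (hx : x ∉ tsupport φ) (P : MvPolynomial (Fin d) ℂ) :
    PDop P φ x = 0 := by
  rw [(PDop_congr (notMem_tsupport_iff_eventuallyEq.1 hx) P).self_of_nhds, PDop_zero]
  rfl

lemma pair_X {X : Set (EE d)} (hX : IsOpen X) {g φ : EE d → ℂ} (hg : ContDiffOn ℝ (⊤ : ℕ∞) g X)
    (hφ : Smooth φ) (hc : HasCompactSupport φ) (hs : tsupport φ ⊆ X)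
    (P : MvPolynomial (Fin d) ℂ) :
    ∫ x, PDop P g x * φ x = ∫ x, g x * PDop (negP P) φ x := by
  obtain ⟨G, g1, g2, g3, g4⟩ := cutoff_fun hX hc hs hg
  have key := ibpP' P g1 hφ hc
  rw [eventually_nhdsSet_iff_forall] at g4
  have e1 : (fun x => PDop P g x * φ x) = fun x => PDop P G x * φ x := by
    funext x
    by_cases hx : x ∈ tsupport φ
    · have : G =ᶠ[𝓝 x] g := g4 x hx
      rw [(PDop_congr this P).self_of_nhds]
    · simp [image_eq_zero_of_notMem_tsupport hx]
  have e2 : (fun x => g x * PDop (negP P) φ x) = fun x => G x * PDop (negP P) φ x := by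
    funext x
    by_cases hx : x ∈ tsupport φ
    · rw [(g4 x hx).self_of_nhds]
    · simp [PDop_off hx]
  rw [e1, e2, key]

/-- solution of a triangular system -/
def trisol (a : ℕ → ℕ → ℂ) (b : ℕ → ℂ) : ℕ → ℂ
  | j => (b j - ∑ i : Fin j, trisol a b i * a j i) / a j j
decreasing_by exact i.2

lemma trisol_spec (a : ℕ → ℕ → ℂ) (b : ℕ → ℂ) (h : ∀ j, a j j ≠ 0) (j : ℕ) :
    ∑ i ∈ Finset.range (j + 1), trisol a b i * a j i = b j := by
  rw [Finset.sum_range_succ, trisol.eq_1 a b j, Finset.sum_range, div_mul_cancel₀ _ (h j)]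
  ring

/-- surjectivity of the operator -/
def Surj (P : MvPolynomial (Fin d) ℂ) (X : Set (EE d)) : Prop :=
  ∀ g : EE d → ℂ, ContDiffOn ℝ (⊤ : ℕ∞) g X → ∃ f : EE d → ℂ, ContDiffOn ℝ (⊤ : ℕ∞) f X ∧
    ∀ x ∈ X, PDop P f x = g x

theorem gliding {P : MvPolynomial (Fin d) ℂ} {X : Set (EE d)} (hX : IsOpen X) (hS : Surj P X)
    {K : Set (EE d)} (hK : IsCompact K) (hKX : K ⊆ X) :
    ∃ K' : Set (EE d), IsCompact K' ∧ K' ⊆ X ∧ ∀ φ : EE d → ℂ, Smooth φ → HasCompactSupport φ →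
      tsupport φ ⊆ X → (∀ x ∉ K, PDop (negP P) φ x = 0) → ∀ x ∉ K', φ x = 0 := by
  by_contra hcon
  push Not at hcon
  let CS := {A : Set (EE d) // IsCompact A ∧ A ⊆ X}
  have hcon' : ∀ A : CS, ∃ φ : EE d → ℂ, Smooth φ ∧ HasCompactSupport φ ∧
      tsupport φ ⊆ X ∧ (∀ x ∉ K, PDop (negP P) φ x = 0) ∧ ∃ x ∉ A.1, φ x ≠ 0 :=
    fun A => hcon A.1 A.2.1 A.2.2
  choose F f1 f2 f3 f4 xF f5 f6 using hcon'
  have hpos : ∀ n : ℕ, (0 : ℝ) < 1 / ((n : ℝ) + 1) := fun n => by positivity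
  let nxt : ℕ → CS → CS := fun n A => ⟨A.1 ∪ tsupport (F A) ∪ LS X n (1 / ((n : ℝ) + 1)),
    (A.2.1.union (f2 A)).union (isCompact_LS _ _ _),
    union_subset (union_subset A.2.2 (f3 A)) (LS_sub (hpos n))⟩
  let A : ℕ → CS := fun n => Nat.rec ⟨∅, isCompact_empty, empty_subset _⟩ nxt n
  have hA : ∀ n, (A (n + 1)).1 = (A n).1 ∪ tsupport (F (A n)) ∪ LS X n (1 / ((n : ℝ) + 1)) :=
    fun n => rfl
  have hmono : Monotone fun n => (A n).1 := monotone_nat_of_le_succ fun n => by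
    rw [hA n]
    exact subset_union_left.trans subset_union_left
  have hsep : ∀ n, ∃ θ : EE d → ℂ, Smooth θ ∧ HasCompactSupport θ ∧
      tsupport θ ⊆ (A n).1ᶜ ∧ ∫ x, F (A n) x * θ x ≠ 0 := fun n =>
    sep (f1 (A n)) (A n).2.1.isClosed.isOpen_compl (f5 (A n)) (f6 (A n))
  choose θ t1 t2 t3 t4 using hsep
  have hθ0 : ∀ m j, m ≤ j → ∀ x ∈ (A m).1, θ j x = 0 := fun m j hmj x hx => by
    by_contra h
    exact t3 j (subset_tsupport _ h) (hmono hmj hx)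
  let a : ℕ → ℕ → ℂ := fun j i => ∫ x, F (A j) x * θ i x
  let N : ℕ → ℝ := fun j => ∫ x, ‖PDop (negP P) (F (A j)) x‖
  let c := trisol a (fun j => ((j * N j + 1 : ℝ) : ℂ))
  have hc := trisol_spec a (fun j => ((j * N j + 1 : ℝ) : ℂ)) t4
  let f : EE d → ℂ := fun x => ∑' j, c j * θ j x
  have hf : ∀ m, ∀ x ∈ (A m).1, f x = ∑ j ∈ Finset.range m, c j * θ j x := by
    intro m x hx
    refine tsum_eq_sum fun j hj => ?_
    rw [hθ0 m j (by simpa using hj) x hx, mul_zero]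
  have hcov : ∀ x ∈ X, ∃ m, (A m).1 ∈ 𝓝 x := by
    intro x hx
    obtain ⟨r, s, hr, hs, hK⟩ := exists_LS (isCompact_singleton (x := x)) hX (by simpa using hx)
    obtain ⟨n1, hn1⟩ := exists_nat_gt r
    obtain ⟨n2, hn2⟩ := exists_nat_one_div_lt hs
    refine ⟨max n1 n2 + 1, ?_⟩
    rw [hA]
    refine mem_of_superset (LS_nhds (r := r) (s := s) ?_ ?_ (hK rfl)) subset_union_right
    · exact hn1.trans_le (by exact_mod_cast le_max_left _ _)
    · refine lt_of_le_of_lt ?_ hn2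
      apply one_div_le_one_div_of_le (by positivity)
      have : (n2 : ℝ) ≤ (max n1 n2 : ℕ) := by exact_mod_cast le_max_right _ _
      linarith
  have hfs : ContDiffOn ℝ (⊤ : ℕ∞) f X := by
    intro x hx
    obtain ⟨m, hm⟩ := hcov x hx
    have hs : Smooth (fun x => ∑ j ∈ Finset.range m, c j * θ j x) :=
      ContDiff.sum fun j _ => contDiff_const.mul (t1 j)
    refine (hs.contDiffAt.congr_of_eventuallyEq ?_).contDiffWithinAt
    filter_upwards [hm] with y hy using hf m y hy
  obtain ⟨g, hg, hPg⟩ := hS f hfs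
  obtain ⟨M, hM⟩ := hK.exists_bound_of_continuousOn (hg.continuousOn.mono hKX)
  have e1 : ∀ j, ∫ x, f x * F (A j) x = ((j * N j + 1 : ℝ) : ℂ) := by
    intro j
    rw [← hc j]
    have : ∀ x, f x * F (A j) x =
        ∑ i ∈ Finset.range (j + 1), c i * (F (A j) x * θ i x) := by
      intro x
      by_cases hx : x ∈ tsupport (F (A j))
      · rw [hf (j + 1) x (by rw [hA]; exact Or.inl (Or.inr hx)), Finset.sum_mul]
        exact Finset.sum_congr rfl fun i _ => by ring
      · simp [image_eq_zero_of_notMem_tsupport hx]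
    simp only [this]
    rw [integral_finsetSum]
    · simp only [integral_const_mul]
      rfl
    · intro i _
      refine Integrable.const_mul ?_ _
      exact ((f1 _).continuous.mul (t1 i).continuous).integrable_of_hasCompactSupport
        ((f2 _).mul_right)
  have e2 : ∀ j, (j * N j + 1 : ℝ) ≤ M * N j := by
    intro j
    have h1 := pair_X hX hg (f1 (A j)) (f2 (A j)) (f3 (A j)) P
    have h2 : (fun x => PDop P g x * F (A j) x) = fun x => f x * F (A j) x := by
      funext x
      by_cases hx : x ∈ tsupport (F (A j))
      · rw [hPg x (f3 _ hx)]
      · simp [image_eq_zero_of_notMem_tsupport hx]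
    rw [h2, e1] at h1
    have h3 : ‖∫ x, g x * PDop (negP P) (F (A j)) x‖ ≤
        ∫ x, M * ‖PDop (negP P) (F (A j)) x‖ := by
      refine norm_integral_le_of_norm_le ?_ (Eventually.of_forall fun x => ?_)
      · exact (((smooth_PDop (f1 _) _).continuous.integrable_of_hasCompactSupport
          (hcs_PDop (f1 _) (f2 _) _)).norm).const_mul _
      · rw [norm_mul]
        by_cases hx : x ∈ K
        · exact mul_le_mul_of_nonneg_right (hM x hx) (norm_nonneg _)
        · simp [f4 (A j) x hx]
    rw [← h1, integral_const_mul, Complex.norm_real] at h3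
    exact (le_abs_self _).trans h3
  obtain ⟨j, hj⟩ := exists_nat_gt M
  have hN : 0 ≤ N j := integral_nonneg fun x => norm_nonneg _
  have := e2 j
  nlinarith

theorem dist_hull {P : MvPolynomial (Fin d) ℂ} {X : Set (EE d)} (hX : IsOpen X) (hS : Surj P X)
    {φ : EE d → ℂ} (hφ : Smooth φ) (hc : HasCompactSupport φ) (hs : tsupport φ ⊆ X) {s : ℝ}
    (h : ∀ x, (∃ y ∉ X, dist x y < s) → PDop (negP P) φ x = 0) :
    ∀ x, (∃ y ∉ X, dist x y < s) → φ x = 0 := by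
  rintro x0 ⟨y, hy, hxy⟩
  by_contra hne
  set v := y - x0 with hv
  have hvs : ‖v‖ < s := by rw [hv, ← dist_eq_norm, dist_comm]; exact hxy
  set K1 := tsupport φ ∩ {x : EE d | ∀ y ∉ X, s ≤ dist x y}
  have hK1 : IsCompact K1 := hc.isCompact.inter_right (isClosed_DS X s)
  set K := (fun p : ℝ × EE d => p.2 + p.1 • v) '' (Icc 0 1 ×ˢ K1)
  have hK : IsCompact K := (isCompact_Icc.prod hK1).image (by fun_prop)
  have hKX : K ⊆ X := by
    rintro _ ⟨⟨t, x⟩, ⟨ht, hx⟩, rfl⟩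
    by_contra hn
    have h1 := hx.2 _ hn
    simp only [dist_self_add_right, norm_smul] at h1
    have h2 : ‖t‖ * ‖v‖ ≤ 1 * ‖v‖ := by
      gcongr
      rw [Real.norm_of_nonneg ht.1]
      exact ht.2
    linarith
  obtain ⟨K', k1, k2, k3⟩ := gliding hX hS hK hKX
  obtain ⟨δ, hδ, hth⟩ := exists_thick k1 hX k2
  obtain ⟨n, hn⟩ := exists_nat_gt (‖v‖ / δ)
  have hn0 : (0 : ℝ) < n := lt_of_le_of_lt (by positivity) hn
  let ψ : ℝ → EE d → ℂ := fun t x => φ (x + -(t • v))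
  have hψs : ∀ t, Smooth (ψ t) := fun t => smooth_comp_add hφ _
  have hts : ∀ t x, x ∈ tsupport (ψ t) ↔ x + -(t • v) ∈ tsupport φ := by
    intro t x
    have := tsupport_comp_eq_preimage φ (Homeomorph.addRight (-(t • v)))
    have h2 : tsupport (ψ t) = _ := this
    rw [h2]
    rfl
  have hψc : ∀ t, HasCompactSupport (ψ t) := fun t =>
    hc.comp_homeomorph (Homeomorph.addRight (-(t • v)))
  have hin : ∀ t ∈ Icc (0 : ℝ) 1, tsupport (ψ t) ⊆ X → tsupport (ψ t) ⊆ K' := by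
    intro t ht hsub
    refine closure_minimal (fun x hx => ?_) k1.isClosed
    by_contra hxK
    apply hx
    refine k3 (ψ t) (hψs t) (hψc t) hsub (fun z hz => ?_) x hxK
    rw [show ψ t = fun x => φ (x + -(t • v)) from rfl, PDop_comp_add]
    by_contra hne'
    apply hz
    refine ⟨(t, z + -(t • v)), ⟨ht, ?_, ?_⟩, by simp⟩
    · by_contra hno
      exact hne' (PDop_off hno _)
    · intro y' hy'
      by_contra hlt
      exact hne' (h _ ⟨y', hy', not_le.1 hlt⟩)
  have hall : ∀ k : ℕ, k ≤ n → tsupport (ψ (k / n)) ⊆ X := by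
    intro k
    induction k with
    | zero =>
      intro _ x hx
      rw [hts] at hx
      apply hs
      simpa using hx
    | succ k ih =>
      intro hk x hx
      have h1 := hin (k / n) ⟨by positivity, by
        rw [div_le_one hn0]
        exact_mod_cast (by omega : k ≤ n)⟩ (ih (by omega))
      rw [hts] at hx
      have h2 : x - (1 / n : ℝ) • v ∈ tsupport (ψ (k / n)) := by
        rw [hts]
        convert hx using 1
        push_cast
        rw [add_div, add_smul]
        abel
      refine hth _ (h1 h2) x ?_
      rw [dist_eq_norm, sub_sub_cancel, norm_smul]
      simp only [one_div, norm_inv, RCLike.norm_natCast]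
      rw [inv_mul_le_iff₀ hn0]
      rw [div_lt_iff₀ hδ] at hn
      exact hn.le
  have hfin := hall n le_rfl
  apply hy
  apply hfin
  apply subset_tsupport
  rw [div_self hn0.ne']
  simp [ψ, hv, hne]

theorem LS_hull {P : MvPolynomial (Fin d) ℂ} (hP : P ≠ 0) {X : Set (EE d)} (hX : IsOpen X)
    (hS : Surj P X) {φ : EE d → ℂ} (hφ : Smooth φ) (hc : HasCompactSupport φ)
    (hs : tsupport φ ⊆ X) {r s : ℝ} (hr : 0 ≤ r)
    (h : ∀ x ∉ LS X r s, PDop (negP P) φ x = 0) : ∀ x ∉ LS X r s, φ x = 0 := by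
  have h1 := ball_hull (negP P) (negP_ne_zero hP) hφ hc hr fun x hx => h x fun hL => by
    linarith [hL.1]
  have h2 := dist_hull hX hS hφ hc hs (s := s) fun x ⟨y, hy, hxy⟩ => h x fun hL => by
    linarith [hL.2 y hy]
  intro x hx
  by_cases hx1 : r < ‖x‖
  · exact h1 x hx1
  · apply h2
    by_contra hno
    push Not at hno
    exact hx ⟨not_lt.1 hx1, hno⟩

end hull
end PDEaux
end

noncomputable section
namespace PDEaux
open MeasureTheory Set Filter Topology
section approx
variable {d : ℕ}

/-- mollifier of radius `r` -/
structure IsMoll (ρ : EE d → ℂ) (r : ℝ) : Prop where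
  smooth : Smooth ρ
  hcs : HasCompactSupport ρ
  off : ∀ x, r ≤ ‖x‖ → ρ x = 0
  even : ∀ x, ρ (-x) = ρ x
  int : ∫ x, ρ x = 1
  intn : ∫ x, ‖ρ x‖ = 1

lemma exists_moll {r : ℝ} (hr : 0 < r) : ∃ ρ : EE d → ℂ, IsMoll ρ r := by
  let b : ContDiffBump (0 : EE d) := ⟨r / 2, r, by positivity, by linarith⟩
  refine ⟨fun x => ((b.normed volume x : ℝ) : ℂ), ?_, ?_, ?_, ?_, ?_, ?_⟩
  · exact Complex.ofRealCLM.contDiff.comp b.contDiff_normed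
  · exact b.hasCompactSupport_normed.comp_left (g := fun x : ℝ => (x : ℂ)) (by simp)
  · intro x hx
    have : x ∉ Function.support (b.normed volume) := by
      rw [b.support_normed_eq]
      simpa [b] using hx
    simpa using this
  · intro x
    rw [b.normed_neg]
  · have := integral_ofReal (𝕜 := ℂ) (μ := (volume : Measure (EE d))) (f := b.normed volume)
    rw [b.integral_normed] at this
    simpa using this
  · have : ∀ x, ‖((b.normed volume x : ℝ) : ℂ)‖ = b.normed volume x := fun x => by
      rw [Complex.norm_real, Real.norm_of_nonneg (b.nonneg_normed x)]
    simp only [this]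
    exact b.integral_normed

lemma IsMoll.integrable {ρ : EE d → ℂ} {r : ℝ} (h : IsMoll ρ r) : Integrable ρ :=
  h.smooth.continuous.integrable_of_hasCompactSupport h.hcs

lemma IsMoll.cv_near {ρ : EE d → ℂ} {r : ℝ} (hρ : IsMoll ρ r) {h : EE d → ℂ} (hh : Continuous h)
    {x : EE d} {c : ℂ} {η : ℝ} (H : ∀ t, dist t x < r → ‖h t - c‖ ≤ η) :
    ‖cv h ρ x - c‖ ≤ η := by
  have hi : Integrable (fun t => ρ (x - t)) := hρ.integrable.comp_sub_left x
  have h1 : ∫ t, ρ (x - t) = 1 := by rw [integral_sub_left_eq_self ρ volume x, hρ.int]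
  have h2 : ∫ t, ‖ρ (x - t)‖ = 1 := by
    rw [integral_sub_left_eq_self (fun t => ‖ρ t‖) volume x, hρ.intn]
  have hi2 : Integrable (fun t => h t * ρ (x - t)) := by
    apply Continuous.integrable_of_hasCompactSupport
    · exact hh.mul (smooth_refl hρ.smooth x).continuous
    · exact (hcs_refl hρ.hcs x).mul_left
  have e : cv h ρ x - c = ∫ t, (h t - c) * ρ (x - t) := by
    simp only [sub_mul]
    rw [integral_sub hi2 (hi.const_mul c), integral_const_mul, h1, mul_one]
    rfl
  rw [e]
  calc ‖∫ t, (h t - c) * ρ (x - t)‖ ≤ ∫ t, η * ‖ρ (x - t)‖ := by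
        apply norm_integral_le_of_norm_le (hi.norm.const_mul η)
        refine Eventually.of_forall fun t => ?_
        rw [norm_mul]
        by_cases ht : dist t x < r
        · gcongr
          exact H t ht
        · rw [hρ.off (x - t) (by rw [← dist_eq_norm, dist_comm]; linarith)]
          simp
    _ = η := by rw [integral_const_mul, h2, mul_one]

lemma IsMoll.cv_zero {ρ : EE d → ℂ} {r : ℝ} (hρ : IsMoll ρ r) {h : EE d → ℂ}
    {x : EE d} (H : ∀ t, dist t x < r → h t = 0) : cv h ρ x = 0 := by
  unfold cv
  rw [integral_eq_zero_of_ae]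
  refine Eventually.of_forall fun t => ?_
  by_cases ht : dist t x < r
  · simp [H t ht]
  · simp [hρ.off (x - t) (by rw [← dist_eq_norm, dist_comm]; linarith)]

lemma IsMoll.pair {ρ : EE d → ℂ} {r : ℝ} (hρ : IsMoll ρ r) {u g : EE d → ℂ}
    (hu : Integrable u) {K : Set (EE d)} (hK : IsCompact K) (huK : ∀ x ∉ K, u x = 0)
    (hg : Smooth g) : ∫ x, g x * cv u ρ x = ∫ x, u x * cv g ρ x := by
  have hA : IsCompact (Metric.cthickening r K) := hK.cthickening
  obtain ⟨χ, c1, c2, -, c4⟩ := cutoff hA isOpen_univ (subset_univ _)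
  rw [eventually_nhdsSet_iff_forall] at c4
  have hχ : ∀ x t, t ∈ K → dist x t < r → χ x = 1 := fun x t ht h =>
    (c4 x (Metric.mem_cthickening_of_dist_le x t r K ht h.le)).self_of_nhds
  obtain ⟨C, hC⟩ := exists_bd hρ.smooth.continuous hρ.hcs
  have hc : Continuous fun x => χ x * g x := c1.continuous.mul hg.continuous
  have hv : Integrable fun x => χ x * g x := hc.integrable_of_hasCompactSupport c2.mul_right
  have hρc := hρ.smooth.continuous
  have key := fub (k := fun x t => ρ (x - t)) hv hu (by fun_prop) (fun x t => hC _)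
  calc ∫ x, g x * cv u ρ x = ∫ x, (χ x * g x) * ∫ t, u t * ρ (x - t) := by
        refine integral_congr_ae (Eventually.of_forall fun x => ?_)
        simp only
        by_cases h : ∃ t ∈ K, dist x t < r
        · obtain ⟨t, ht, h⟩ := h
          rw [hχ x t ht h, one_mul]
          rfl
        · push Not at h
          have e : cv u ρ x = 0 := hρ.cv_zero fun t ht => huK t fun htK => by
            have := h t htK
            rw [dist_comm] at this
            linarith
          have e' : ∫ t, u t * ρ (x - t) = 0 := e
          rw [e, e', mul_zero, mul_zero]
    _ = _ := key
    _ = _ := by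
        refine integral_congr_ae (Eventually.of_forall fun t => ?_)
        simp only
        by_cases ht : t ∈ K
        · congr 1
          refine integral_congr_ae (Eventually.of_forall fun x => ?_)
          simp only
          rw [← hρ.even (x - t), neg_sub]
          by_cases hx : dist x t < r
          · rw [hχ x t ht hx, one_mul]
          · rw [hρ.off (t - x) (by rw [← dist_eq_norm, dist_comm]; linarith)]
            simp
        · rw [huK t ht, zero_mul, zero_mul]

/-- Hilbert space separation, giving `L¹` approximation. -/
lemma L1_approx {V : Submodule ℂ (EE d → ℂ)} (hV : ∀ g ∈ V, Continuous g) {f : EE d → ℂ}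
    (hf : Continuous f) {K : Set (EE d)} (hK : IsCompact K)
    (H : ∀ u : EE d → ℂ, Integrable u → (∀ x ∉ K, u x = 0) → (∀ g ∈ V, ∫ x, u x * g x = 0) →
      ∫ x, u x * f x = 0) {ε : ℝ} (hε : 0 < ε) :
    ∃ g ∈ V, ∫ x in K, ‖g x - f x‖ < ε := by
  set μ : Measure (EE d) := volume.restrict K with hμ
  have hfin : IsFiniteMeasure μ := ⟨by rw [hμ, Measure.restrict_apply_univ]; exact hK.measure_lt_top⟩
  have hmem : ∀ g : EE d → ℂ, Continuous g → MemLp g 2 μ := fun g hg => by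
    obtain ⟨C, hC⟩ := hK.exists_bound_of_continuousOn hg.continuousOn
    refine MemLp.of_bound hg.aestronglyMeasurable C ?_
    rw [hμ]
    exact ae_restrict_of_forall_mem hK.measurableSet hC
  let T : V →ₗ[ℂ] Lp ℂ 2 μ :=
    { toFun := fun g => (hmem g.1 (hV g.1 g.2)).toLp
      map_add' := fun a b => rfl
      map_smul' := fun c a => rfl }
  have hin : ∀ (u : Lp ℂ 2 μ) (g : EE d → ℂ) (hg : Continuous g),
      inner ℂ u ((hmem g hg).toLp) =
        ∫ x, K.indicator (fun x => (starRingEnd ℂ) (u x)) x * g x := by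
    intro u g hg
    rw [L2.inner_def]
    have : ∀ x, K.indicator (fun x => (starRingEnd ℂ) (u x)) x * g x =
        K.indicator (fun x => (starRingEnd ℂ) (u x) * g x) x := fun x => by
      by_cases hx : x ∈ K <;> simp [hx]
    simp only [this]
    rw [integral_indicator hK.measurableSet]
    refine integral_congr_ae ?_
    filter_upwards [(hmem g hg).coeFn_toLp] with x hx
    rw [hx]
    simp [mul_comm]
  have hmemF : (hmem f hf).toLp ∈ (LinearMap.range T).topologicalClosure := by
    rw [← Submodule.orthogonal_orthogonal_eq_closure, Submodule.mem_orthogonal]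
    intro u hu
    rw [hin u f hf]
    apply H
    · rw [integrable_indicator_iff hK.measurableSet]
      have h1 : Integrable u μ := (Lp.memLp u).integrable (by norm_num)
      exact (Complex.conjCLE.toContinuousLinearMap.integrable_comp h1)
    · intro x hx
      simp [hx]
    · intro g hg
      rw [← hin u g (hV g hg)]
      rw [Submodule.mem_orthogonal'] at hu
      exact hu _ ⟨⟨g, hg⟩, rfl⟩
  set C : ℝ := (μ univ ^ (1 / 2 : ℝ)).toReal with hC
  have hCne : μ univ ^ (1 / 2 : ℝ) ≠ ⊤ := ENNReal.rpow_ne_top_of_nonneg (by norm_num) (measure_ne_top _ _)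
  have hC0 : 0 ≤ C := ENNReal.toReal_nonneg
  have hε' : 0 < ε / (C + 1) := by positivity
  obtain ⟨z, hz1, hz2⟩ := Metric.mem_closure_iff.1 hmemF _ hε'
  obtain ⟨g, rfl⟩ := hz1
  refine ⟨g.1, g.2, ?_⟩
  have hgc := hV g.1 g.2
  have hm := hmem (fun x => g.1 x - f x) (hgc.sub hf)
  have e1 : ∫ x in K, ‖g.1 x - f x‖ = (eLpNorm (fun x => g.1 x - f x) 1 μ).toReal := by
    rw [eLpNorm_one_eq_lintegral_enorm, integral_norm_eq_lintegral_enorm hm.1]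
  have e2 : (eLpNorm (fun x => g.1 x - f x) 2 μ).toReal < ε / (C + 1) := by
    rw [dist_comm, dist_eq_norm] at hz2
    have : T g - (hmem f hf).toLp = hm.toLp := rfl
    rw [this, Lp.norm_toLp] at hz2
    exact hz2
  have h2 := eLpNorm_le_eLpNorm_mul_rpow_measure_univ (μ := μ) (p := 1) (q := 2)
    (by norm_num) hm.1
  rw [show (1 / (1 : ENNReal).toReal - 1 / (2 : ENNReal).toReal : ℝ) = 1 / 2 by norm_num] at h2
  have h3 := ENNReal.toReal_mono (ENNReal.mul_ne_top hm.2.ne hCne) h2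
  rw [ENNReal.toReal_mul] at h3
  rw [e1]
  calc _ ≤ (eLpNorm (fun x => g.1 x - f x) 2 μ).toReal * C := h3
    _ ≤ ε / (C + 1) * C := by gcongr
    _ < ε := by
      rw [div_mul_eq_mul_div, div_lt_iff₀ (by positivity)]
      nlinarith

end approx
end PDEaux
end

noncomputable section
namespace PDEaux
open MeasureTheory Set Filter Topology
section stepD
variable {d : ℕ}

lemma smooth_mderivE {f : EE d → ℂ} (hf : Smooth f) (α : Fin d → ℕ) : Smooth (mderivE α f) := by
  rw [mderivE_eq]
  exact smooth_PDop hf _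

lemma hcs_mderivE {f : EE d → ℂ} (hf : Smooth f) (hc : HasCompactSupport f) (α : Fin d → ℕ) :
    HasCompactSupport (mderivE α f) := by
  rw [mderivE_eq]
  exact hcs_PDop hf hc _

lemma finite_idx (l : ℕ) : {α : Fin d → ℕ | ∑ i, α i ≤ l}.Finite :=
  (Set.finite_Iic (fun _ : Fin d => l)).subset fun α hα i =>
    (Finset.single_le_sum (f := α) (fun _ _ => Nat.zero_le _) (Finset.mem_univ i)).trans hα

lemma exists_bd_all {f : EE d → ℂ} (hf : Smooth f) (hc : HasCompactSupport f) (l : ℕ) :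
    ∃ M : ℝ, 0 ≤ M ∧ ∀ α : Fin d → ℕ, ∑ i, α i ≤ l → ∀ x, ‖mderivE α f x‖ ≤ M := by
  have h : ∀ α : Fin d → ℕ, ∃ C, ∀ x, ‖mderivE α f x‖ ≤ C := fun α =>
    exists_bd (smooth_mderivE hf α).continuous (hcs_mderivE hf hc α)
  choose C hC using h
  refine ⟨∑ α ∈ (finite_idx l).toFinset, |C α|, Finset.sum_nonneg fun _ _ => abs_nonneg _,
    fun α hα x => (hC α x).trans ((le_abs_self _).trans ?_)⟩
  exact Finset.single_le_sum (f := fun α => |C α|) (fun _ _ => abs_nonneg _)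
    ((finite_idx l).mem_toFinset.2 hα)

lemma exists_unif_all {f : EE d → ℂ} (hf : Smooth f) (hc : HasCompactSupport f) (l : ℕ)
    {ε : ℝ} (hε : 0 < ε) :
    ∃ δ : ℝ, 0 < δ ∧ ∀ α : Fin d → ℕ, ∑ i, α i ≤ l → ∀ x y, dist x y < δ →
      ‖mderivE α f x - mderivE α f y‖ ≤ ε := by
  have h : ∀ᶠ δ : ℝ in 𝓝[>] 0, ∀ α ∈ {α : Fin d → ℕ | ∑ i, α i ≤ l}, ∀ x y, dist x y < δ →
      ‖mderivE α f x - mderivE α f y‖ ≤ ε := by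
    rw [eventually_all_finite (finite_idx l)]
    intro α _
    have hu : UniformContinuous (mderivE α f) :=
      (smooth_mderivE hf α).continuous.uniformContinuous_of_tendsto_cocompact
        (hcs_mderivE hf hc α).is_zero_at_infty
    obtain ⟨δ, hδ, h⟩ := Metric.uniformContinuous_iff.1 hu ε hε
    filter_upwards [Ioo_mem_nhdsGT hδ] with δ' hδ' x y hxy
    rw [← dist_eq_norm]
    exact (h (hxy.trans hδ'.2)).le
  obtain ⟨δ, h1, h2⟩ := (h.and self_mem_nhdsWithin).exists
  exact ⟨δ, h2, h1⟩

lemma mderivE_cv_left {g ρ : EE d → ℂ} (hg : Smooth g) (hρ : Smooth ρ) (hc : HasCompactSupport ρ)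
    (α : Fin d → ℕ) : mderivE α (cv g ρ) = cv (mderivE α g) ρ := by
  rw [mderivE_eq, mderivE_eq, cv_PDop_left hg hρ hc]

lemma mderivE_cv_right {g ρ : EE d → ℂ} (hg : Smooth g) (hρ : Smooth ρ) (hc : HasCompactSupport ρ)
    (α : Fin d → ℕ) : mderivE α (cv g ρ) = cv g (mderivE α ρ) := by
  rw [mderivE_eq, mderivE_eq, PDop_cv hg.continuous.locallyIntegrable _ hρ hc]

lemma cv_add {g h ρ : EE d → ℂ} (hg : Continuous g) (hh : Continuous h) (hρ : Continuous ρ)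
    (hc : HasCompactSupport ρ) : cv (g + h) ρ = cv g ρ + cv h ρ := by
  funext x
  have hi : ∀ g : EE d → ℂ, Continuous g → Integrable fun t => g t * ρ (x - t) := fun g hg => by
    apply Continuous.integrable_of_hasCompactSupport
    · fun_prop
    · exact (hcs_refl hc x).mul_left
  simp only [cv, Pi.add_apply, add_mul]
  rw [integral_add (hi g hg) (hi h hh)]

lemma cv_smul (c : ℂ) (g ρ : EE d → ℂ) : cv (c • g) ρ = c • cv g ρ := by
  funext x
  simp only [cv, Pi.smul_apply, smul_eq_mul, mul_assoc]
  rw [integral_const_mul]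

lemma cv_zero_left (ρ : EE d → ℂ) : cv 0 ρ = 0 := by
  funext x
  simp [cv]

/-- solutions near `U`, mollified -/
def VV (P : MvPolynomial (Fin d) ℂ) (U : Set (EE d)) {ρ : EE d → ℂ} (hρ : Smooth ρ)
    (hc : HasCompactSupport ρ) : Submodule ℂ (EE d → ℂ) where
  carrier := {h | ∃ g : EE d → ℂ, Smooth g ∧ (∀ x ∈ U, PDop P g x = 0) ∧ h = cv g ρ}
  add_mem' := by
    rintro _ _ ⟨g, g1, g2, rfl⟩ ⟨h, h1, h2, rfl⟩
    refine ⟨g + h, g1.add h1, fun x hx => ?_,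
      (cv_add g1.continuous h1.continuous hρ.continuous hc).symm⟩
    rw [PDop_add g1 h1, Pi.add_apply, g2 x hx, h2 x hx, add_zero]
  zero_mem' := ⟨0, contDiff_const, fun x _ => by rw [PDop_zero]; rfl, (cv_zero_left ρ).symm⟩
  smul_mem' := by
    rintro c _ ⟨g, g1, g2, rfl⟩
    refine ⟨c • g, g1.const_smul c, fun x hx => ?_, (cv_smul c g ρ).symm⟩
    rw [PDop_smul g1, Pi.smul_apply, g2 x hx, smul_zero]

theorem stepD {P : MvPolynomial (Fin d) ℂ} (hP : P ≠ 0) {X : Set (EE d)} (hX : IsOpen X)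
    (hS : Surj P X) {f : EE d → ℂ} (hf : Smooth f) (hc : HasCompactSupport f) {r s : ℝ}
    (hr : 0 ≤ r) (hs : 0 < s) (hPf : ∀ x ∈ LS X r s, PDop P f x = 0) {K : Set (EE d)}
    (hK : IsCompact K) {δ : ℝ} (hδ : 0 < δ) (hKL : ∀ x ∈ K, ∀ z, dist z x ≤ δ → z ∈ LS X r s)
    {U : Set (EE d)} (hU : IsCompact U) (hUX : U ⊆ X) (l : ℕ) {ε : ℝ} (hε : 0 < ε) :
    ∃ g : EE d → ℂ, Smooth g ∧ HasCompactSupport g ∧ (∀ x ∈ U, PDop P g x = 0) ∧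
      ∀ α : Fin d → ℕ, ∑ i, α i ≤ l → ∀ x ∈ K, ‖mderivE α g x - mderivE α f x‖ ≤ ε := by
  obtain ⟨δ1, hδ1, hthick⟩ := hU.exists_cthickening_subset_open hX hUX
  obtain ⟨δ2, hδ2, hunif⟩ := exists_unif_all hf hc l (ε := ε / 2) (by positivity)
  obtain ⟨r0, hr0, q1, q2, q3⟩ : ∃ r0 : ℝ, 0 < r0 ∧ 2 * r0 ≤ δ ∧ 2 * r0 ≤ δ1 ∧ 2 * r0 ≤ δ2 := by
    refine ⟨min δ (min δ1 δ2) / 2, by positivity, ?_, ?_, ?_⟩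
    · linarith [min_le_left δ (min δ1 δ2)]
    · linarith [min_le_right δ (min δ1 δ2), min_le_left δ1 δ2]
    · linarith [min_le_right δ (min δ1 δ2), min_le_right δ1 δ2]
  obtain ⟨ρ, hρ⟩ := exists_moll (d := d) hr0
  obtain ⟨M, hM0, hM⟩ := exists_bd_all hρ.smooth hρ.hcs l
  set K' := Metric.cthickening r0 K with hK'def
  have hK' : IsCompact K' := hK.cthickening
  have hK'mem : ∀ t ∈ K', ∃ k ∈ K, dist t k ≤ r0 := fun t ht => by
    rw [hK'def, hK.cthickening_eq_biUnion_closedBall hr0.le] at ht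
    simpa using ht
  set U2 := Metric.cthickening δ1 U ∪ LS X r s with hU2def
  have hU2 : IsCompact U2 := hU.cthickening.union (isCompact_LS X r s)
  have hU2X : U2 ⊆ X := union_subset hthick (LS_sub hs)
  have hcvs : ∀ g : EE d → ℂ, Smooth g → Smooth (cv g ρ) := fun g hg =>
    smooth_cv hg.continuous.locallyIntegrable hρ.smooth hρ.hcs
  have happ : ∃ h ∈ VV P U2 hρ.smooth hρ.hcs,
      ∫ x in K', ‖h x - cv f ρ x‖ < ε / 2 / (M + 1) := by
    refine L1_approx ?_ (hcvs f hf).continuous hK' ?_ (by positivity)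
    · rintro _ ⟨g, g1, -, rfl⟩
      exact (hcvs g g1).continuous
    · intro u hu hu0 hort
      rw [← hρ.pair hu hK' hu0 hf]
      set w := cv u ρ with hwdef
      have hw : Smooth w := smooth_cv hu.locallyIntegrable hρ.smooth hρ.hcs
      have hwL : ∀ x ∉ LS X r s, w x = 0 := fun x hx => by
        refine hρ.cv_zero fun t ht => hu0 t fun htK => hx ?_
        obtain ⟨k, hk, hkt⟩ := hK'mem t htK
        refine hKL k hk x ?_
        have := dist_triangle x t k
        rw [dist_comm x t] at this
        linarith
      obtain ⟨φ, p1, p2, p3, p4⟩ := dual_solv P hP hw hU2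
        (fun x hx => hwL x fun h => hx (Or.inr h)) (fun g g1 g2 => by
          rw [hwdef, hρ.pair hu hK' hu0 g1]
          exact hort _ ⟨g, g1, g2, rfl⟩)
      have hts : tsupport φ ⊆ X := by
        refine (closure_minimal ?_ hU2.isClosed).trans hU2X
        intro x hx
        by_contra h
        exact hx (p3 x h)
      have hφ := LS_hull hP hX hS p1 p2 hts hr (fun x hx => by rw [p4]; exact hwL x hx)
      rw [← p4, ibpP' P hf p1 p2]
      rw [integral_eq_zero_of_ae]
      refine Eventually.of_forall fun x => ?_
      by_cases hx : x ∈ LS X r s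
      · simp [hPf x hx]
      · simp [hφ x hx]
  obtain ⟨_, ⟨g, g1, g2, rfl⟩, hg⟩ := happ
  set G := cv (cv g ρ) ρ with hG
  have hGs : Smooth G := hcvs _ (hcvs g g1)
  have hPG : ∀ x ∈ U, PDop P G x = 0 := by
    intro x hx
    rw [hG, cv_PDop_left (hcvs g g1) hρ.smooth hρ.hcs, cv_PDop_left g1 hρ.smooth hρ.hcs]
    refine hρ.cv_zero fun t ht => hρ.cv_zero fun y hy => g2 y (Or.inl ?_)
    refine Metric.mem_cthickening_of_dist_le y x δ1 U hx ?_
    linarith [dist_triangle y t x]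
  have hρoff : ∀ (α : Fin d → ℕ) x, r0 < ‖x‖ → mderivE α ρ x = 0 := fun α x hx => by
    rw [mderivE_eq]
    refine PDop_off (fun h => ?_) _
    have : tsupport ρ ⊆ Metric.closedBall 0 r0 := by
      refine closure_minimal (fun y hy => ?_) Metric.isClosed_closedBall
      by_contra h
      refine hy (hρ.off y ?_)
      rw [mem_closedBall_zero_iff] at h
      linarith
    have := this h
    rw [mem_closedBall_zero_iff] at this
    linarith
  have hest : ∀ α : Fin d → ℕ, ∑ i, α i ≤ l → ∀ x ∈ K, ‖mderivE α G x - mderivE α f x‖ ≤ ε := by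
    intro α hα x hx
    set D : EE d → ℂ := fun t => cv g ρ t - cv f ρ t with hD
    have hDs : Smooth D := (hcvs g g1).sub (hcvs f hf)
    have e0 : cv g ρ = D + cv f ρ := by funext t; simp [hD]
    have e1 : mderivE α G x = cv D (mderivE α ρ) x + cv (cv (mderivE α f) ρ) ρ x := by
      rw [hG, e0, cv_add hDs.continuous (hcvs f hf).continuous hρ.smooth.continuous hρ.hcs,
        mderivE_eq, PDop_add (hcvs _ hDs) (hcvs _ (hcvs f hf)), ← mderivE_eq, ← mderivE_eq,
        mderivE_cv_right hDs hρ.smooth hρ.hcs, mderivE_cv_left (hcvs f hf) hρ.smooth hρ.hcs,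
        mderivE_cv_left hf hρ.smooth hρ.hcs]
      rfl
    have hA : ‖cv D (mderivE α ρ) x‖ ≤ ε / 2 := by
      have hDi : IntegrableOn (fun t => ‖D t‖) K' :=
        hDs.continuous.norm.continuousOn.integrableOn_compact hK'
      have e2 : cv D (mderivE α ρ) x = ∫ t in K', D t * mderivE α ρ (x - t) := by
        unfold cv
        rw [setIntegral_eq_integral_of_forall_compl_eq_zero]
        intro t ht
        rw [hρoff α (x - t), mul_zero]
        by_contra hle
        refine ht (Metric.mem_cthickening_of_dist_le t x r0 K hx ?_)
        rw [dist_comm, dist_eq_norm]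
        linarith
      rw [e2]
      calc _ ≤ ∫ t in K', ‖D t‖ * M := by
            refine norm_integral_le_of_norm_le (hDi.mul_const M) (Eventually.of_forall fun t => ?_)
            rw [norm_mul]
            gcongr
            exact hM α hα _
        _ ≤ ε / 2 / (M + 1) * M := by
            rw [integral_mul_const]
            gcongr
        _ ≤ ε / 2 := by
            rw [div_mul_eq_mul_div, div_le_iff₀ (by positivity)]
            nlinarith
    have hB : ‖cv (cv (mderivE α f) ρ) ρ x - mderivE α f x‖ ≤ ε / 2 := by
      have hfs := smooth_mderivE hf α
      refine hρ.cv_near (hcvs _ hfs).continuous fun t ht => hρ.cv_near hfs.continuous fun y hy => ?_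
      refine hunif α hα y x ?_
      linarith [dist_triangle y t x]
    rw [e1, add_sub_assoc]
    exact (norm_add_le _ _).trans (by linarith)
  obtain ⟨F, F1, F2, -, F4⟩ := cutoff_fun isOpen_univ (hU.union hK) (subset_univ _) hGs.contDiffOn
  rw [eventually_nhdsSet_iff_forall] at F4
  refine ⟨F, F1, F2, fun x hx => ?_, fun α hα x hx => ?_⟩
  · have : F =ᶠ[𝓝 x] G := F4 x (Or.inl hx)
    rw [(PDop_congr this P).self_of_nhds, hPG x hx]
  · have : F =ᶠ[𝓝 x] G := F4 x (Or.inr hx)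
    rw [(mderivE_congr this α).self_of_nhds]
    exact hest α hα x hx

end stepD
end PDEaux
end

noncomputable section
namespace PDEaux
open MeasureTheory Set Filter Topology
section lim
variable {d : ℕ}

lemma mderivE_succ {f : EE d → ℂ} (hf : Smooth f) (α : Fin d → ℕ) (i : Fin d) :
    mderivE (α + Pi.single i 1) f = pderivE i (mderivE α f) := by
  rw [mderivE_eq, mderivE_eq, ← PDop_X (smooth_PDop hf _) i, ← PDop_mul hf]
  congr 1
  rw [MvPolynomial.X, MvPolynomial.monomial_mul, one_mul]
  have : Finsupp.equivFunOnFinite.symm (α + Pi.single i 1) =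
      Finsupp.single i 1 + Finsupp.equivFunOnFinite.symm α := by
    ext j
    by_cases h : j = i
    · subst h
      simp [add_comm]
    · simp [h]
  rw [this]

/-- linear functional with given partial derivatives -/
def lam (c : Fin d → ℂ) : EE d →L[ℝ] ℂ := ∑ i, (EuclideanSpace.proj i : EE d →L[ℝ] ℝ).smulRight (c i)

lemma lam_single (c : Fin d → ℂ) (i : Fin d) : lam c (EuclideanSpace.single i 1) = c i := by
  simp [lam]

lemma lam_of_clm (T : EE d →L[ℝ] ℂ) : T = lam fun i => T (EuclideanSpace.single i 1) := by
  apply ContinuousLinearMap.coe_injective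
  refine (EuclideanSpace.basisFun (Fin d) ℝ).toBasis.ext fun i => ?_
  simp only [OrthonormalBasis.coe_toBasis, EuclideanSpace.basisFun_apply]
  exact (lam_single (fun i => T (EuclideanSpace.single i 1)) i).symm

lemma lam_sub (a b : Fin d → ℂ) : lam a - lam b = lam fun i => a i - b i := by
  rw [lam_of_clm (lam a - lam b)]
  congr 1
  funext i
  simp [lam_single]

lemma lam_bound {c : Fin d → ℂ} {η : ℝ} (h : ∀ i, ‖c i‖ ≤ η) :
    ‖lam c‖ ≤ (∑ i, ‖(EuclideanSpace.proj i : EE d →L[ℝ] ℝ)‖) * η := by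
  unfold lam
  rw [Finset.sum_mul]
  refine (norm_sum_le _ _).trans (Finset.sum_le_sum fun i _ => ?_)
  rw [ContinuousLinearMap.norm_smulRight_apply]
  gcongr
  exact h i

theorem limit_lemma {X : Set (EE d)} (hX : IsOpen X) {f : ℕ → EE d → ℂ} (hf : ∀ k, Smooth (f k))
    {A : ℕ → Set (EE d)} (hA : Monotone A) (hAX : ∀ x ∈ X, ∃ n, A n ∈ 𝓝 x) {C : ℝ}
    (h : ∀ k, ∀ α : Fin d → ℕ, ∑ i, α i ≤ k → ∀ x ∈ A k,
      ‖mderivE α (f (k + 1)) x - mderivE α (f k) x‖ ≤ C * (1 / 2) ^ k) :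
    ∃ F : EE d → ℂ, ContDiffOn ℝ (⊤ : ℕ∞) F X ∧
      ∀ α : Fin d → ℕ, ∀ x ∈ X, Tendsto (fun k => mderivE α (f k) x) atTop (𝓝 (mderivE α F x)) := by
  have hshift : ∀ (α : Fin d → ℕ) (m k : ℕ), m ≤ k → ∑ i, α i ≤ k → ∀ x ∈ A m, ∀ j,
      dist (mderivE α (f (j + k)) x) (mderivE α (f (j + 1 + k)) x) ≤
        (C * (1 / 2) ^ k) * (1 / 2) ^ j := by
    intro α m k hmk hα x hx j
    have := h (j + k) α (by omega) x (hA (by omega : m ≤ j + k) hx)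
    rw [dist_comm, dist_eq_norm, show j + 1 + k = j + k + 1 by omega]
    refine this.trans (le_of_eq ?_)
    ring
  obtain ⟨G, hG⟩ : ∃ G : (Fin d → ℕ) → EE d → ℂ, ∀ (α : Fin d → ℕ) (m : ℕ), ∀ x ∈ A m,
      Tendsto (fun k => mderivE α (f k) x) atTop (𝓝 (G α x)) := by
    refine ⟨fun α x => limUnder atTop fun k => mderivE α (f k) x, ?_⟩
    intro α m x hx
    have hc := cauchySeq_of_le_geometric (1 / 2) _ (by norm_num)
      (hshift α m (max m (∑ i, α i)) (le_max_left _ _) (le_max_right _ _) x hx)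
    obtain ⟨a, ha⟩ := cauchySeq_tendsto_of_complete hc
    rw [tendsto_add_atTop_iff_nat (f := fun j => mderivE α (f j) x)] at ha
    exact tendsto_nhds_limUnder ⟨a, ha⟩
  have hGX : ∀ (α : Fin d → ℕ), ∀ x ∈ X,
      Tendsto (fun k => mderivE α (f k) x) atTop (𝓝 (G α x)) := by
    intro α x hx
    obtain ⟨n, hn⟩ := hAX x hx
    exact hG α n x (mem_of_mem_nhds hn)
  have htail : ∀ (α : Fin d → ℕ) (m k : ℕ), m ≤ k → ∑ i, α i ≤ k → ∀ x ∈ A m,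
      ‖G α x - mderivE α (f k) x‖ ≤ 2 * C * (1 / 2) ^ k := by
    intro α m k hmk hα x hx
    have h1 := dist_le_of_le_geometric_of_tendsto (1 / 2) _ (by norm_num) (hshift α m k hmk hα x hx)
      ((tendsto_add_atTop_iff_nat (f := fun j => mderivE α (f j) x) k).2 (hG α m x hx)) 0
    rw [dist_comm, dist_eq_norm, zero_add] at h1
    refine h1.trans (le_of_eq ?_)
    ring
  have hder : ∀ (α : Fin d → ℕ), ∀ x ∈ X,
      HasFDerivAt (G α) (lam fun i => G (α + Pi.single i 1) x) x := by
    intro α x hx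
    have h1 : TendstoLocallyUniformlyOn
        (fun (k : ℕ) (x : EE d) => lam fun i => mderivE (α + Pi.single i 1) (f k) x)
        (fun x => lam fun i => G (α + Pi.single i 1) x) atTop X := by
      rw [Metric.tendstoLocallyUniformlyOn_iff]
      intro ε hε y hy
      obtain ⟨n, hn⟩ := hAX y hy
      refine ⟨A n, mem_nhdsWithin_of_mem_nhds hn, ?_⟩
      have hz : Tendsto (fun k : ℕ => (∑ i, ‖(EuclideanSpace.proj i : EE d →L[ℝ] ℝ)‖) *
          (2 * C * (1 / 2) ^ k)) atTop (𝓝 0) := by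
        have := (tendsto_pow_atTop_nhds_zero_of_lt_one (r := (1 / 2 : ℝ)) (by norm_num)
          (by norm_num)).const_mul ((∑ i, ‖(EuclideanSpace.proj i : EE d →L[ℝ] ℝ)‖) * (2 * C))
        rw [mul_zero] at this
        refine this.congr fun k => ?_
        ring
      filter_upwards [hz.eventually (gt_mem_nhds hε), eventually_ge_atTop n,
        eventually_ge_atTop (∑ i, α i + 1)] with k h1 h2 h3 z hzA
      rw [dist_eq_norm, lam_sub]
      refine (lam_bound fun i => ?_).trans_lt h1
      refine htail _ n k h2 ?_ z hzA
      simp only [Pi.add_apply, Finset.sum_add_distrib]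
      rw [Finset.sum_pi_single']
      simpa using h3
    have h2 : ∀ (k : ℕ), ∀ x ∈ X, HasFDerivAt (mderivE α (f k))
        (lam fun i => mderivE (α + Pi.single i 1) (f k) x) x := by
      intro k y _
      have hs := smooth_mderivE (hf k) α
      have := (hs.diff y).hasFDerivAt
      rw [lam_of_clm (fderiv ℝ (mderivE α (f k)) y)] at this
      refine this.congr_fderiv ?_
      congr 1
      funext i
      rw [mderivE_succ (hf k)]
      rfl
    exact hasFDerivAt_of_tendstoLocallyUniformlyOn (𝕜 := ℝ) hX h1 h2 (hGX α) hx
  have hcd : ∀ n : ℕ, ∀ α : Fin d → ℕ, ContDiffOn ℝ n (G α) X := by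
    intro n
    induction n with
    | zero =>
      intro α
      exact contDiffOn_zero.2 fun x hx => (hder α x hx).continuousAt.continuousWithinAt
    | succ n ih =>
      intro α
      push_cast
      rw [contDiffOn_succ_iff_fderiv_of_isOpen hX]
      refine ⟨fun x hx => (hder α x hx).differentiableAt.differentiableWithinAt, by simp, ?_⟩
      have : ContDiffOn ℝ n (fun x => lam fun i => G (α + Pi.single i 1) x) X := by
        unfold lam
        refine ContDiffOn.sum fun i _ => ?_
        exact contDiffOn_const.smulRight (ih _)
      exact this.congr fun x hx => (hder α x hx).fderiv
  have hF : ContDiffOn ℝ (⊤ : ℕ∞) (G 0) X := contDiffOn_infty.2 fun n => hcd n 0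
  have hid : ∀ n : ℕ, ∀ α : Fin d → ℕ, ∑ i, α i = n → ∀ x ∈ X, mderivE α (G 0) x = G α x := by
    intro n
    induction n with
    | zero =>
      intro α hα x hx
      have : α = 0 := by
        funext i
        exact (Finset.sum_eq_zero_iff.1 hα) i (Finset.mem_univ i)
      subst this
      exact congrFun (mderivE_zero_idx (G 0)) x
    | succ n ih =>
      intro α hα x hx
      obtain ⟨i, hi⟩ : ∃ i, α i ≠ 0 := by
        by_contra hcon
        push Not at hcon
        simp [hcon] at hα
      obtain ⟨β, rfl⟩ : ∃ β : Fin d → ℕ, α = β + Pi.single i 1 := by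
        refine ⟨α - Pi.single i 1, ?_⟩
        funext j
        by_cases hj : j = i
        · subst hj
          simp
          omega
        · simp [hj]
      have hβ : ∑ i, β i = n := by
        simp only [Pi.add_apply, Finset.sum_add_distrib] at hα
        rw [Finset.sum_pi_single'] at hα
        simpa using hα
      obtain ⟨Φ, p1, p2, p3, p4⟩ := cutoff_fun hX (isCompact_singleton (x := x)) (by simpa using hx) hF
      rw [eventually_nhdsSet_iff_forall] at p4
      have e : Φ =ᶠ[𝓝 x] G 0 := p4 x rfl
      rw [← (mderivE_congr e _).self_of_nhds, mderivE_succ p1]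
      have e2 : mderivE β Φ =ᶠ[𝓝 x] G β := by
        filter_upwards [mderivE_congr e β, hX.mem_nhds hx] with y h1 h2
        rw [h1, ih β hβ y h2]
      unfold pderivE
      rw [e2.fderiv_eq, (hder β x hx).fderiv, lam_single]
  refine ⟨G 0, hF, fun α x hx => ?_⟩
  rw [hid _ α rfl x hx]
  exact hGX α x hx

lemma PDop_tendsto {P : MvPolynomial (Fin d) ℂ} {f : ℕ → EE d → ℂ} {F : EE d → ℂ} {x : EE d}
    (h : ∀ α : Fin d → ℕ, Tendsto (fun k => mderivE α (f k) x) atTop (𝓝 (mderivE α F x))) :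
    Tendsto (fun k => PDop P (f k) x) atTop (𝓝 (PDop P F x)) :=
  tendsto_finsetSum _ fun α _ => (h _).const_mul _

lemma tail_bound {f : ℕ → EE d → ℂ} {F : EE d → ℂ} {x : EE d} {α : Fin d → ℕ} {C : ℝ}
    (ht : Tendsto (fun k => mderivE α (f k) x) atTop (𝓝 (mderivE α F x)))
    (h : ∀ k, ‖mderivE α (f (k + 1)) x - mderivE α (f k) x‖ ≤ C * (1 / 2) ^ k) :
    ‖mderivE α F x - mderivE α (f 0) x‖ ≤ 2 * C := by
  have := dist_le_of_le_geometric_of_tendsto (1 / 2) C (by norm_num)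
    (fun k => by rw [dist_comm, dist_eq_norm]; exact h k) ht 0
  rw [dist_comm, dist_eq_norm] at this
  refine this.trans (le_of_eq ?_)
  ring

lemma cSemiNorm_le {l : ℕ} {K : Set (EE d)} {f : EE d → ℂ} {c : ℝ} (hc : 0 ≤ c)
    (h : ∀ α : Fin d → ℕ, ∑ i, α i ≤ l → ∀ x ∈ K, ‖mderivE α f x‖ ≤ c) : cSemiNorm l K f ≤ c :=
  Real.iSup_le (fun _ => Real.iSup_le (fun hα => Real.iSup_le (fun x =>
    Real.iSup_le (fun hx => h _ hα x hx) hc) hc) hc) hc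

lemma le_cSemiNorm {l : ℕ} {K : Set (EE d)} {f : EE d → ℂ} {M : ℝ}
    (h : ∀ α : Fin d → ℕ, ∑ i, α i ≤ l → ∀ x ∈ K, ‖mderivE α f x‖ ≤ M) {α : Fin d → ℕ}
    (hα : ∑ i, α i ≤ l) {x : EE d} (hx : x ∈ K) : ‖mderivE α f x‖ ≤ cSemiNorm l K f := by
  have hM : 0 ≤ M := (norm_nonneg _).trans (h α hα x hx)
  have b0 : ∀ (β : Fin d → ℕ) (_ : ∑ i, β i ≤ l) (y : EE d), (⨆ (_ : y ∈ K), ‖mderivE β f y‖) ≤ M :=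
    fun β hβ y => Real.iSup_le (fun hy => h β hβ y hy) hM
  have b1 : ∀ (β : Fin d → ℕ) (_ : ∑ i, β i ≤ l),
      (⨆ y, ⨆ (_ : y ∈ K), ‖mderivE β f y‖) ≤ M := fun β hβ => Real.iSup_le (b0 β hβ) hM
  have b2 : ∀ (β : Fin d → ℕ), (⨆ (_ : ∑ i, β i ≤ l), ⨆ y, ⨆ (_ : y ∈ K), ‖mderivE β f y‖) ≤ M :=
    fun β => Real.iSup_le (b1 β) hM
  unfold cSemiNorm
  refine le_ciSup_of_le ⟨M, by rintro _ ⟨β, rfl⟩; exact b2 β⟩ α ?_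
  refine le_ciSup_of_le ⟨M, by rintro _ ⟨hβ, rfl⟩; exact b1 α hβ⟩ hα ?_
  refine le_ciSup_of_le ⟨M, by rintro _ ⟨y, rfl⟩; exact b0 α hα y⟩ x ?_
  exact le_ciSup_of_le ⟨M, by rintro _ ⟨hy, rfl⟩; exact h α hα x hy⟩ hx le_rfl

end lim
end PDEaux
end

noncomputable section
namespace PDEaux
open MeasureTheory Set Filter Topology
section main
variable {d : ℕ}

lemma exists_seq_dep {β : Type*} (p : ℕ → β → Prop) (q : ℕ → β → β → Prop) (b0 : β) (h0 : p 0 b0)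
    (h : ∀ k b, p k b → ∃ b', p (k + 1) b' ∧ q k b b') :
    ∃ f : ℕ → β, f 0 = b0 ∧ (∀ k, p k (f k)) ∧ ∀ k, q k (f k) (f (k + 1)) := by
  choose! F hF1 hF2 using h
  let f : ℕ → β := fun n => Nat.rec b0 F n
  have hp : ∀ k, p k (f k) := fun k => by
    induction k with
    | zero => exact h0
    | succ k ih => exact hF1 k _ ih
  exact ⟨f, rfl, hp, fun k => hF2 k _ (hp k)⟩

lemma exh_mem {X : Set (EE d)} {n : ℕ} {x : EE d} (hx : x ∈ exhSet X n) :
    ∃ r s : ℝ, r < n ∧ 1 / (n : ℝ) < s ∧ x ∈ LS X r s := by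
  obtain ⟨h1, h2, h3⟩ := hx
  obtain ⟨s, hs0, hs1, hs2⟩ := ENNReal.lt_iff_exists_real_btwn.1 h3
  refine ⟨‖x‖, s, h2, ?_, le_rfl, fun y hy => ?_⟩
  · exact (ENNReal.ofReal_lt_ofReal_iff_of_nonneg (by positivity)).1 hs1
  · have := hs2.le.trans (Metric.infEDist_le_edist_of_mem (x := x) (mem_compl hy))
    rw [edist_dist] at this
    exact (ENNReal.ofReal_le_ofReal_iff dist_nonneg).1 this

lemma exh_LS {X : Set (EE d)} {n : ℕ} {r s : ℝ} (hr : r < n) (hs : 1 / (n : ℝ) < s) :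
    LS X r s ⊆ exhSet X n := by
  intro x hx
  have hn : (0 : ℝ) ≤ 1 / (n : ℝ) := by positivity
  have hs0 : 0 < s := hn.trans_lt hs
  refine ⟨LS_sub hs0 hx, hx.1.trans_lt hr, ?_⟩
  refine ((ENNReal.ofReal_lt_ofReal_iff hs0).2 hs).trans_le ?_
  refine Metric.le_infEDist.2 fun y hy => ?_
  rw [edist_dist]
  exact ENNReal.ofReal_le_ofReal (hx.2 y hy)

lemma exh_nhds {X : Set (EE d)} {n : ℕ} {x : EE d} (hx : x ∈ exhSet X n) :
    ∃ r s : ℝ, r < n ∧ 1 / (n : ℝ) < s ∧ LS X r s ∈ 𝓝 x := by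
  obtain ⟨r, s, hr, hs, h⟩ := exh_mem hx
  obtain ⟨r', h1, h2⟩ := exists_between hr
  obtain ⟨s', h3, h4⟩ := exists_between hs
  exact ⟨r', s', h2, h3, LS_nhds h1 h4 h⟩

lemma isOpen_exh (X : Set (EE d)) (n : ℕ) : IsOpen (exhSet X n) := by
  rw [isOpen_iff_mem_nhds]
  intro x hx
  obtain ⟨r, s, hr, hs, h⟩ := exh_nhds hx
  exact mem_of_superset h (exh_LS hr hs)

lemma exh_compact {X : Set (EE d)} {n : ℕ} {K : Set (EE d)} (hK : IsCompact K)
    (h : K ⊆ exhSet X n) (hn : 1 ≤ n) :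
    ∃ r s : ℝ, 0 ≤ r ∧ r < n ∧ 1 / (n : ℝ) < s ∧ K ⊆ LS X r s := by
  have hn' : (0 : ℝ) < n := by exact_mod_cast hn
  refine hK.induction_on (p := fun S => ∃ r s : ℝ, 0 ≤ r ∧ r < n ∧ 1 / (n : ℝ) < s ∧ S ⊆ LS X r s)
    ⟨0, 1 / (n : ℝ) + 1, le_rfl, hn', by linarith, empty_subset _⟩ ?_ ?_ ?_
  · rintro S T hST ⟨r, s, h0, h1, h2, h3⟩
    exact ⟨r, s, h0, h1, h2, hST.trans h3⟩
  · rintro S T ⟨r, s, h0, h1, h2, h3⟩ ⟨r', s', h0', h1', h2', h3'⟩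
    exact ⟨max r r', min s s', le_max_of_le_left h0, max_lt h1 h1', lt_min h2 h2',
      union_subset (h3.trans (LS_mono (le_max_left _ _) (min_le_left _ _)))
        (h3'.trans (LS_mono (le_max_right _ _) (min_le_right _ _)))⟩
  · intro x hx
    obtain ⟨r, s, hr, hs, hh⟩ := exh_nhds (h hx)
    refine ⟨LS X r s, mem_nhdsWithin_of_mem_nhds hh, max r 0, s, le_max_right _ _,
      max_lt hr hn', hs, LS_mono (le_max_left _ _) le_rfl⟩

theorem M2 {P : MvPolynomial (Fin d) ℂ} (hP : P ≠ 0) {X : Set (EE d)} (hX : IsOpen X)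
    (hS : Surj P X) {n : ℕ} (hn : 1 ≤ n) : DenseRestriction P X (exhSet X n) := by
  intro f hf hPf l K hK hKX ε hε
  obtain ⟨r, s, hr0, hr, hs, hKLS⟩ := exh_compact hK hKX hn
  obtain ⟨r1, hr1, hr1'⟩ := exists_between hr
  obtain ⟨s1, hs1', hs1⟩ := exists_between hs
  have hs10 : 0 < s1 := lt_of_le_of_lt (by positivity) hs1'
  have hs0 : 0 < s := hs10.trans hs1
  have hr10 : 0 ≤ r1 := hr0.trans hr1.le
  let Lk : ℕ → Set (EE d) := fun k => LS X (r1 + k) (s1 / (k + 1))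
  let A : ℕ → Set (EE d) := fun k => LS X (r + k) (s / (k + 1))
  have hL0 : Lk 0 = LS X r1 s1 := by simp [Lk]
  have hA0 : A 0 = LS X r s := by simp [A]
  have hAmono : Monotone A := fun i j hij => by
    have : (i : ℝ) ≤ j := by exact_mod_cast hij
    exact LS_mono (by linarith) (by gcongr)
  have hAL : A 0 ⊆ Lk 0 := by
    rw [hA0, hL0]
    exact LS_mono hr1.le hs1.le
  obtain ⟨f0, p1, p2, p3, p4⟩ := cutoff_fun (isOpen_exh X n) (isCompact_LS X r1 s1)
    (exh_LS hr1' hs1') hf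
  rw [eventually_nhdsSet_iff_forall] at p4
  have hpf0 : ∀ x ∈ Lk 0, PDop P f0 x = 0 := fun x hx => by
    rw [hL0] at hx
    have e : f0 =ᶠ[𝓝 x] f := p4 x hx
    rw [(PDop_congr e P).self_of_nhds]
    exact hPf x (exh_LS hr1' hs1' hx)
  obtain ⟨F, F0, F1, F2⟩ := exists_seq_dep
    (fun k (g : EE d → ℂ) => Smooth g ∧ HasCompactSupport g ∧ ∀ x ∈ Lk k, PDop P g x = 0)
    (fun k g g' => ∀ α : Fin d → ℕ, ∑ i, α i ≤ max k l → ∀ x ∈ A k,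
      ‖mderivE α g' x - mderivE α g x‖ ≤ ε / 4 * (1 / 2) ^ k) f0 ⟨p1, p2, hpf0⟩ (by
    rintro k g ⟨g1, g2, g3⟩
    have hk1 : (0 : ℝ) < (k : ℝ) + 1 := by positivity
    have hδ : 0 < min (r1 - r) ((s - s1) / (k + 1)) :=
      lt_min (by linarith) (div_pos (by linarith) hk1)
    have hthick : ∀ x ∈ A k, ∀ z, dist z x ≤ min (r1 - r) ((s - s1) / (k + 1)) →
        z ∈ LS X (r1 + k) (s1 / (k + 1)) := by
      intro x hx z hz
      refine LS_mono ?_ ?_ (LS_thick hx hz)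
      · linarith [min_le_left (r1 - r) ((s - s1) / (k + 1))]
      · have h2 := min_le_right (r1 - r) ((s - s1) / (k + 1))
        have h3 : (s - s1) / ((k : ℝ) + 1) = s / (k + 1) - s1 / (k + 1) := sub_div _ _ _
        linarith
    obtain ⟨g', q1, q2, q3, q4⟩ := stepD hP hX hS g1 g2 (by positivity) (by positivity) g3
      (isCompact_LS X _ _) hδ hthick (U := Lk (k + 1)) (isCompact_LS X _ _)
      (LS_sub (by positivity)) (max k l) (ε := ε / 4 * (1 / 2) ^ k) (by positivity)
    exact ⟨g', ⟨q1, q2, q3⟩, q4⟩)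
  have hAX : ∀ x ∈ X, ∃ k, A k ∈ 𝓝 x := by
    intro x hx
    obtain ⟨r', s', h1, h2, h3⟩ := exists_LS (isCompact_singleton (x := x)) hX (by simpa using hx)
    obtain ⟨n1, hn1⟩ := exists_nat_gt r'
    obtain ⟨n2, hn2⟩ := exists_nat_gt (s / s')
    refine ⟨max n1 n2, LS_nhds ?_ ?_ (h3 rfl)⟩
    · have : (n1 : ℝ) ≤ (max n1 n2 : ℕ) := by exact_mod_cast le_max_left _ _
      linarith
    · have : (n2 : ℝ) ≤ (max n1 n2 : ℕ) := by exact_mod_cast le_max_right _ _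
      rw [div_lt_iff₀ h2] at hn2
      rw [div_lt_iff₀ (by positivity)]
      nlinarith
  obtain ⟨g, g1, g2⟩ := limit_lemma hX (fun k => (F1 k).1) hAmono hAX (C := ε / 4)
    (fun k α hα x hx => F2 k α (hα.trans (le_max_left _ _)) x hx)
  refine ⟨g, g1, fun x hx => ?_, ?_⟩
  · have ht := PDop_tendsto (P := P) (fun α => g2 α x hx)
    refine tendsto_nhds_unique ht (tendsto_const_nhds.congr' ?_)
    obtain ⟨m, hm⟩ := hAX x hx
    filter_upwards [eventually_ge_atTop m] with k hk
    have hxA : x ∈ A k := hAmono hk (mem_of_mem_nhds hm)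
    refine ((F1 k).2.2 x ?_).symm
    exact LS_mono (by linarith) (by gcongr) hxA
  · refine (cSemiNorm_le (c := ε / 2) (by positivity) fun α hα x hx => ?_).trans_lt (by linarith)
    have hxA : x ∈ A 0 := hA0 ▸ hKLS hx
    have hxX : x ∈ X := LS_sub hs0 (hKLS hx)
    have hb := tail_bound (g2 α x hxX) (fun k =>
      F2 k α (hα.trans (le_max_right _ _)) x (hAmono (Nat.zero_le k) hxA))
    rw [F0] at hb
    obtain ⟨Γ, c1, c2, -, c4⟩ := cutoff_fun hX (isCompact_singleton (x := x)) (by simpa using hxX) g1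
    rw [eventually_nhdsSet_iff_forall] at c4
    have e1 : Γ =ᶠ[𝓝 x] g := c4 x rfl
    have e2 : f0 =ᶠ[𝓝 x] f := p4 x (hL0 ▸ hAL hxA)
    have e3 : (fun y => g y - f y) =ᶠ[𝓝 x] Γ - f0 := by
      filter_upwards [e1, e2] with y h1 h2
      simp [h1, h2]
    rw [(mderivE_congr e3 α).self_of_nhds, mderivE_eq, PDop_sub c1 p1, ← mderivE_eq, ← mderivE_eq,
      Pi.sub_apply, (mderivE_congr e1 α).self_of_nhds]
    linarith

lemma exists_bd_compact {f : EE d → ℂ} (hf : Smooth f) {K : Set (EE d)} (hK : IsCompact K)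
    (l : ℕ) : ∃ M : ℝ, ∀ α : Fin d → ℕ, ∑ i, α i ≤ l → ∀ x ∈ K, ‖mderivE α f x‖ ≤ M := by
  obtain ⟨F, F1, F2, -, F4⟩ := cutoff_fun isOpen_univ hK (subset_univ _) hf.contDiffOn
  rw [eventually_nhdsSet_iff_forall] at F4
  obtain ⟨M, -, hM⟩ := exists_bd_all F1 F2 l
  refine ⟨M, fun α hα x hx => ?_⟩
  have e : F =ᶠ[𝓝 x] f := F4 x hx
  rw [← (mderivE_congr e α).self_of_nhds]
  exact hM α hα x

theorem M1 {P : MvPolynomial (Fin d) ℂ} (hP : P ≠ 0) {X : Set (EE d)} (hX : IsOpen X)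
    {Y : ℕ → Set (EE d)}
    (hY : ∀ n : ℕ, IsOpen (Y n) ∧ Y n ⊆ X ∧ IsCompact (closure (Y n)) ∧ closure (Y n) ⊆ Y (n + 1))
    (hU : (⋃ n, Y n) = X) (hD : ∀ n, DenseRestriction P X (Y n)) : Surj P X := by
  intro h hh
  have hYm : Monotone Y := monotone_nat_of_le_succ fun n => subset_closure.trans (hY n).2.2.2
  have hcX : ∀ n, closure (Y n) ⊆ X := fun n => (hY n).2.2.2.trans (hY (n + 1)).2.1
  have hloc : ∀ n, ∃ F : EE d → ℂ, Smooth F ∧ ∀ x ∈ Y n, PDop P F x = h x := by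
    intro n
    obtain ⟨H, H1, H2, -, H4⟩ := cutoff_fun hX (hY n).2.2.1 (hcX n) hh
    rw [eventually_nhdsSet_iff_forall] at H4
    obtain ⟨R, hR0, hR⟩ := (hY n).2.2.1.isBounded.subset_ball_lt 0 (0 : EE d)
    obtain ⟨F, F1, F2⟩ := local_solv P hP H1 H2 R
    refine ⟨F, F1, fun x hx => ?_⟩
    have hxc := subset_closure hx
    have := hR hxc
    rw [mem_ball_zero_iff] at this
    rw [F2 x this.le]
    exact (H4 x hxc).self_of_nhds
  obtain ⟨f0, hf0, hf0'⟩ := hloc 1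
  obtain ⟨F, -, F1, F2⟩ := exists_seq_dep
    (fun k (g : EE d → ℂ) => Smooth g ∧ ∀ x ∈ Y (k + 1), PDop P g x = h x)
    (fun k g g' => ∀ α : Fin d → ℕ, ∑ i, α i ≤ k → ∀ x ∈ closure (Y k),
      ‖mderivE α g' x - mderivE α g x‖ ≤ 1 * (1 / 2) ^ k) f0 ⟨hf0, hf0'⟩ (by
    rintro k f ⟨f1, f2⟩
    obtain ⟨G, G1, G2⟩ := hloc (k + 1 + 1)
    have hd : Smooth (G - f) := G1.sub f1
    obtain ⟨g, g1, g2, g3⟩ := hD (k + 1) (G - f) hd.contDiffOn (fun x hx => by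
      rw [PDop_sub G1 f1, Pi.sub_apply, f2 x hx, G2 x (hYm (Nat.le_succ _) hx), sub_self])
      k (closure (Y k)) (hY k).2.2.1 (hY k).2.2.2 ((1 / 2) ^ k) (by positivity)
    obtain ⟨Γ, c1, c2, -, c4⟩ := cutoff_fun hX (hY (k + 1 + 1)).2.2.1 (hcX _) g1
    rw [eventually_nhdsSet_iff_forall] at c4
    refine ⟨G - Γ, ⟨G1.sub c1, fun x hx => ?_⟩, fun α hα x hx => ?_⟩
    · have e : Γ =ᶠ[𝓝 x] g := c4 x (subset_closure hx)
      rw [PDop_sub G1 c1, Pi.sub_apply, G2 x hx, (PDop_congr e P).self_of_nhds,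
        g2 x ((hY _).2.1 hx), sub_zero]
    · have hnear : ∀ y ∈ closure (Y k), (fun y => g y - (G - f) y) =ᶠ[𝓝 y] Γ - (G - f) := by
        intro y hy
        have e : Γ =ᶠ[𝓝 y] g := c4 y (closure_mono (hYm (by omega)) hy)
        filter_upwards [e] with z hz
        simp [hz]
      obtain ⟨M, hM⟩ := exists_bd_compact (c1.sub hd) (hY k).2.2.1 k
      have hle := le_cSemiNorm (f := fun y => g y - (G - f) y) (M := M) (l := k)
        (K := closure (Y k)) (fun β hβ y hy => by
          rw [(mderivE_congr (hnear y hy) β).self_of_nhds]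
          exact hM β hβ y hy) hα hx
      rw [(mderivE_congr (hnear x hx) α).self_of_nhds, mderivE_eq, PDop_sub c1 hd,
        PDop_sub G1 f1] at hle
      rw [mderivE_eq, mderivE_eq, PDop_sub G1 c1, one_mul]
      refine le_trans (le_of_eq ?_) (hle.trans g3.le)
      rw [← norm_neg]
      congr 1
      simp only [Pi.sub_apply]
      ring)
  have hAX : ∀ x ∈ X, ∃ n, x ∈ Y n := fun x hx => by
    rw [← hU] at hx
    simpa using hx
  obtain ⟨g, g1, g2⟩ := limit_lemma hX (fun k => (F1 k).1) (A := fun k => closure (Y k))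
    (fun i j hij => closure_mono (hYm hij)) (fun x hx => by
      obtain ⟨n, hn⟩ := hAX x hx
      exact ⟨n, mem_of_superset ((hY n).1.mem_nhds hn) subset_closure⟩) F2
  refine ⟨g, g1, fun x hx => ?_⟩
  have ht := PDop_tendsto (P := P) (fun α => g2 α x hx)
  refine tendsto_nhds_unique ht (tendsto_const_nhds.congr' ?_)
  obtain ⟨m, hm⟩ := hAX x hx
  filter_upwards [eventually_ge_atTop m] with k hk
  exact ((F1 k).2 x (hYm (by omega : m ≤ k + 1) hm)).symm

theorem M3 {P : MvPolynomial (Fin d) ℂ} {X : Set (EE d)} (hX : IsOpen X)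
    (h : ∀ n : ℕ, 1 ≤ n → DenseRestriction P X (exhSet X n)) :
    ∃ Y : ℕ → Set (EE d),
        (∀ n : ℕ, IsOpen (Y n) ∧ Y n ⊆ X ∧ IsCompact (closure (Y n)) ∧
          closure (Y n) ⊆ Y (n + 1)) ∧
        (⋃ n, Y n) = X ∧
        ∀ n : ℕ, DenseRestriction P X (Y n) := by
  have hsub : ∀ n : ℕ, closure (exhSet X n) ⊆ LS X n (1 / (n : ℝ)) := fun n => by
    refine closure_minimal (fun x hx => ?_) (isCompact_LS _ _ _).isClosed
    obtain ⟨r, s, hr, hs, hx'⟩ := exh_mem hx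
    exact LS_mono hr.le hs.le hx'
  refine ⟨fun n => exhSet X (n + 1), fun n => ⟨isOpen_exh X _, fun x hx => hx.1, ?_, ?_⟩, ?_,
    fun n => h _ (by omega)⟩
  · exact (isCompact_LS _ _ _).of_isClosed_subset isClosed_closure (hsub _)
  · refine (hsub _).trans (exh_LS (by push_cast; linarith) ?_)
    exact one_div_lt_one_div_of_lt (by positivity) (by push_cast; linarith)
  · apply Subset.antisymm
    · exact iUnion_subset fun n x hx => hx.1
    · intro x hx
      obtain ⟨r, s, h1, h2, h3⟩ := exists_LS (isCompact_singleton (x := x)) hX (by simpa using hx)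
      obtain ⟨n1, hn1⟩ := exists_nat_gt r
      obtain ⟨n2, hn2⟩ := exists_nat_one_div_lt h2
      rw [mem_iUnion]
      refine ⟨max n1 n2, exh_LS (r := r) (s := s) ?_ ?_ (h3 rfl)⟩
      · have : (n1 : ℝ) ≤ (max n1 n2 : ℕ) := by exact_mod_cast le_max_left _ _
        push_cast at this ⊢
        linarith
      · have : (n2 : ℝ) ≤ (max n1 n2 : ℕ) := by exact_mod_cast le_max_right _ _
        refine lt_of_le_of_lt ?_ hn2
        apply one_div_le_one_div_of_le (by positivity)
        push_cast at this ⊢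
        linarith

end main
end PDEaux
end

/-- For a nonzero polynomial `P` and an open `X ⊆ ℝ^d`, surjectivity of
`P(∂)` on `C^∞(X)` (i.e. `P`-convexity for supports) is equivalent to dense range of the
restriction maps `C_P^∞(X) → C_P^∞(X_n)` for the canonical exhaustion `(X_n)`, and to the
existence of some open relatively compact exhaustion with this dense-range property. -/
theorem surjective_iff_dense_restrictions
    {d : ℕ} (P : MvPolynomial (Fin d) ℂ) (hP : P ≠ 0)
    (X : Set (EuclideanSpace ℝ (Fin d))) (hX : IsOpen X) :
    -- (i) ↔ (ii)
    ((∀ g : EuclideanSpace ℝ (Fin d) → ℂ, ContDiffOn ℝ (⊤ : ℕ∞) g X →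
        ∃ f : EuclideanSpace ℝ (Fin d) → ℂ, ContDiffOn ℝ (⊤ : ℕ∞) f X ∧
          ∀ x ∈ X, PDop P f x = g x) ↔
      (∀ n : ℕ, 1 ≤ n → DenseRestriction P X (exhSet X n))) ∧
    -- (ii) ↔ (iii)
    ((∀ n : ℕ, 1 ≤ n → DenseRestriction P X (exhSet X n)) ↔
      (∃ Y : ℕ → Set (EuclideanSpace ℝ (Fin d)),
        (∀ n : ℕ, IsOpen (Y n) ∧ Y n ⊆ X ∧ IsCompact (closure (Y n)) ∧
          closure (Y n) ⊆ Y (n + 1)) ∧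
        (⋃ n, Y n) = X ∧
        ∀ n : ℕ, DenseRestriction P X (Y n))) := by
  have h13 : (∃ Y : ℕ → Set (EuclideanSpace ℝ (Fin d)),
        (∀ n : ℕ, IsOpen (Y n) ∧ Y n ⊆ X ∧ IsCompact (closure (Y n)) ∧
          closure (Y n) ⊆ Y (n + 1)) ∧
        (⋃ n, Y n) = X ∧
        ∀ n : ℕ, DenseRestriction P X (Y n)) → PDEaux.Surj P X := by
    rintro ⟨Y, h1, h2, h3⟩
    exact PDEaux.M1 hP hX h1 h2 h3
  refine ⟨⟨fun h n hn => PDEaux.M2 hP hX h hn, fun h => h13 (PDEaux.M3 hX h)⟩,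
    ⟨fun h => PDEaux.M3 hX h, fun h n hn => PDEaux.M2 hP hX (h13 h) hn⟩⟩

end
end

section
/- Let d ≥ 2, X ⊆ ℝ^d open, n ∈ ℕ and X_n := {x ∈ X : |x| < n and dist(x, ℝ^d∖X) > 1/n}. If X∖X_n is the disjoint union of a set F that is closed in X and a compact set K, then K = ∅. -/
noncomputable section

/-- For `d ≥ 2`, if `X∖X_n` is the disjoint union of a relatively closed
subset `F` of `X` and a compact set `K`, then `K = ∅`. -/
theorem compact_part_empty
    {d : ℕ} (hd : 2 ≤ d) (X : Set (EuclideanSpace ℝ (Fin d))) (hX : IsOpen X)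
    (n : ℕ) (hn : 1 ≤ n)
    (F K : Set (EuclideanSpace ℝ (Fin d)))
    (hF : ∃ F' : Set (EuclideanSpace ℝ (Fin d)), IsClosed F' ∧ F = F' ∩ X)
    (hK : IsCompact K)
    (hdisj : Disjoint F K)
    (hunion : X \ exhSet X n = F ∪ K) :
    K = ∅ := by
  obtain ⟨F', hF'c, rfl⟩ := hF
  by_contra hne
  have hKne : K.Nonempty := Set.nonempty_iff_ne_empty.mpr hne
  have hKX : K ⊆ X \ exhSet X n := by rw [hunion]; exact Set.subset_union_right
  -- moving slightly from a point of `K` in a direction avoiding `X_n` stays in `K`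
  have key : ∀ x ∈ K, ∀ v : EuclideanSpace ℝ (Fin d), ∃ t : ℝ, 0 < t ∧ t < 1 ∧
      x + t • v ∈ X ∧ (x + t • v ∉ exhSet X n → x + t • v ∈ K) := by
    intro x hx v
    have hxX : x ∈ X := (hKX hx).1
    have hxF : x ∉ F' := fun h => Set.disjoint_left.mp hdisj ⟨h, hxX⟩ hx
    have hcont : Continuous (fun t : ℝ => x + t • v) := by fun_prop
    have h0 : Filter.Tendsto (fun t : ℝ => x + t • v) (nhdsWithin 0 (Set.Ioi 0)) (nhds x) := by
      have := hcont.tendsto 0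
      simp only [zero_smul, add_zero] at this
      exact this.mono_left nhdsWithin_le_nhds
    have e1 := h0.eventually (hX.mem_nhds hxX)
    have e2 := h0.eventually (hF'c.isOpen_compl.mem_nhds hxF)
    have e3 : ∀ᶠ t : ℝ in nhdsWithin 0 (Set.Ioi 0), t ∈ Set.Ioo (0 : ℝ) 1 :=
      Ioo_mem_nhdsGT one_pos
    obtain ⟨t, h1, h2, h3⟩ := (e1.and (e2.and e3)).exists
    refine ⟨t, h3.1, h3.2, h1, fun hnot => ?_⟩
    have hm : x + t • v ∈ (F' ∩ X) ∪ K := by rw [← hunion]; exact ⟨h1, hnot⟩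
    exact hm.resolve_left (fun h => h2 h.1)
  have hn' : (1 : ℝ) ≤ n := by exact_mod_cast hn
  by_cases hA : ∃ x ∈ K, (n : ℝ) ≤ ‖x‖
  · obtain ⟨x, hx, hxn⟩ := hA
    obtain ⟨y, hy, hmax⟩ := hK.exists_isMaxOn hKne continuous_norm.continuousOn
    have hyn : (n : ℝ) ≤ ‖y‖ := hxn.trans (hmax hx)
    obtain ⟨t, ht0, -, -, hk⟩ := key y hy y
    have hnorm : ‖y + t • y‖ = (1 + t) * ‖y‖ := by
      have : y + t • y = (1 + t) • y := by rw [add_smul, one_smul]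
      rw [this, norm_smul, Real.norm_of_nonneg (by linarith)]
    have hlt : ‖y‖ < ‖y + t • y‖ := by rw [hnorm]; nlinarith
    have hmem := hk (fun h => by have := h.2.1; linarith)
    have h5 : ‖y + t • y‖ ≤ ‖y‖ := hmax hmem
    linarith
  · push Not at hA
    obtain ⟨x, hx, hmin⟩ := hK.exists_isMinOn hKne
      (Metric.continuous_infDist_pt Xᶜ).continuousOn
    have hd0 : ∀ z ∈ K, EMetric.infEdist z Xᶜ ≤ ENNReal.ofReal (1 / (n : ℝ)) := by
      intro z hz
      by_contra h
      exact (hKX hz).2 ⟨(hKX hz).1, hA z hz, not_le.mp h⟩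
    have hXc : (Xᶜ).Nonempty := by
      by_contra h
      have : Metric.infEDist x Xᶜ ≤ ENNReal.ofReal (1 / (n : ℝ)) := hd0 x hx
      rw [Set.not_nonempty_iff_eq_empty.mp h] at this
      simp at this
    obtain ⟨p, hp, hpd⟩ := hX.isClosed_compl.exists_infDist_eq_dist hXc x
    obtain ⟨t, ht0, ht1, -, hk⟩ := key x hx (p - x)
    have hxp : 0 < dist x p := dist_pos.mpr (fun h => hp (h ▸ (hKX hx).1))
    have hdist : dist (x + t • (p - x)) p = (1 - t) * dist x p := by
      have : x + t • (p - x) - p = (1 - t) • (x - p) := by module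
      rw [dist_eq_norm, dist_eq_norm, this, norm_smul, Real.norm_of_nonneg (by linarith)]
    have hlt : dist (x + t • (p - x)) p < dist x p := by rw [hdist]; nlinarith
    have hxle : dist x p ≤ 1 / (n : ℝ) := by
      rw [← hpd]
      exact ENNReal.toReal_le_of_le_ofReal (by positivity) (hd0 x hx)
    have hmem := hk (fun h => by
      refine absurd h.2.2 (not_lt.mpr ?_)
      refine (Metric.infEDist_le_edist_of_mem hp).trans ?_
      rw [edist_dist]
      exact ENNReal.ofReal_le_ofReal (hlt.le.trans hxle))
    have h5 : Metric.infDist x Xᶜ ≤ Metric.infDist (x + t • (p - x)) Xᶜ := hmin hmem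
    have h6 := Metric.infDist_le_dist_of_mem (x := x + t • (p - x)) hp
    linarith

end
end
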